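/- arXiv:0706.4118 — 2 statements merged into one kernel-verified Lean document; each statement's English description precedes it below -/
import Mathlib

section
/- Let N ≥ 1 and α > 0, and let 1 ≤ σ < 4/(N−2) (with 4/(N−2) interpreted as ∞ when N ≤ 2). Then there exists an exponent r, with 2 < r ≤ 2N/(N−2) (interpreted as 2 < r < ∞ when N ≤ 2), and a constant C_α > 0 depending only on N, σ, α and r, with the following property: for all Schwartz functions v₁, v₂ : ℝ^N → ℂ, if u₁, u₂ : ℝ^N → ℝ are Schwartz functions satisfying u_j − α²Δu_j = |v_j|^{σ+1} pointwise on ℝ^N (j = 1, 2), and f_j := u_j · |v_j|^{σ−1} v_j, then ‖f₁ − f₂‖_{L^{r'}} ≤ C_α (‖v₁‖_{H¹} + ‖v₂‖_{H¹})^{2σ} ‖v₁ − v₂‖_{L^r}, where 1/r + 1/r' = 1. -/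
open MeasureTheory Real Set
open scoped ENNReal NNReal ComplexConjugate

noncomputable section

/-- Standard basis vector of `ℝ^N`. -/
def basisVec (N : ℕ) (i : Fin N) : EuclideanSpace ℝ (Fin N) :=
  EuclideanSpace.single i 1

/-- The Laplacian of a function on `ℝ^N`. -/
def lap {E : Type*} [NormedAddCommGroup E] [NormedSpace ℝ E]
    (N : ℕ) (u : EuclideanSpace ℝ (Fin N) → E) (x : EuclideanSpace ℝ (Fin N)) : E :=
  ∑ i : Fin N, fderiv ℝ (fun y => fderiv ℝ u y (basisVec N i)) x (basisVec N i)

/-- The `L^p` norm (with real exponent `p`) of a function on `ℝ^N`. -/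
def LpN (N : ℕ) {E : Type*} [NormedAddCommGroup E]
    (f : EuclideanSpace ℝ (Fin N) → E) (p : ℝ) : ℝ :=
  (eLpNorm f (ENNReal.ofReal p) volume).toReal

/-- The `L²` norm of the (total) derivative of a function on `ℝ^N`. -/
def gradL2 (N : ℕ) (v : EuclideanSpace ℝ (Fin N) → ℂ) : ℝ :=
  (eLpNorm (fun x => fderiv ℝ v x) 2 volume).toReal

/-- The `H¹` norm of a function on `ℝ^N`. -/
def H1norm (N : ℕ) (v : EuclideanSpace ℝ (Fin N) → ℂ) : ℝ :=
  Real.sqrt ((LpN N v 2) ^ 2 + (gradL2 N v) ^ 2)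

open Filter Topology

section Holder

variable {X : Type*} [MeasurableSpace X] {μ : Measure X}
  {E E₁ E₂ E₃ : Type*} [NormedAddCommGroup E] [NormedAddCommGroup E₁]
  [NormedAddCommGroup E₂] [NormedAddCommGroup E₃]

lemma eLpNorm_ofReal_eq_lintegral {p : ℝ} (hp : 0 < p) (f : X → E) :
    eLpNorm f (ENNReal.ofReal p) μ = (∫⁻ x, ‖f x‖ₑ ^ p ∂μ) ^ (1 / p) := by
  rw [eLpNorm_eq_lintegral_rpow_enorm_toReal (by simpa using hp) ENNReal.ofReal_ne_top,
    ENNReal.toReal_ofReal hp.le]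

/-- Hölder's inequality for a function dominated by a product of powers of three functions. -/
lemma eLpNorm_le_of_enorm_le_rpow_mul {F : X → E} {f : X → E₁} {g : X → E₂} {h : X → E₃}
    (hf : AEStronglyMeasurable f μ) (hg : AEStronglyMeasurable g μ)
    (hh : AEStronglyMeasurable h μ) {r p q s a b c : ℝ} (hr : 0 < r) (hp : 0 < p) (hq : 0 < q)
    (hs : 0 < s) (ha : 0 ≤ a) (hb : 0 ≤ b) (hc : 0 ≤ c) (habc : a / p + b / q + c / s = 1 / r)
    {K : ℝ≥0∞} (hF : ∀ x, ‖F x‖ₑ ≤ K * (‖f x‖ₑ ^ a * ‖g x‖ₑ ^ b * ‖h x‖ₑ ^ c)) :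
    eLpNorm F (ENNReal.ofReal r) μ ≤ K * (eLpNorm f (ENNReal.ofReal p) μ ^ a *
      eLpNorm g (ENNReal.ofReal q) μ ^ b * eLpNorm h (ENNReal.ofReal s) μ ^ c) := by
  have key := ENNReal.lintegral_prod_norm_pow_le (μ := μ) (Finset.univ : Finset (Fin 3))
    (f := ![fun x => ‖f x‖ₑ ^ p, fun x => ‖g x‖ₑ ^ q, fun x => ‖h x‖ₑ ^ s])
    (p := ![a * r / p, b * r / q, c * r / s])
    (by
      intro i _
      fin_cases i
      · exact hf.enorm.pow_const _
      · exact hg.enorm.pow_const _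
      · exact hh.enorm.pow_const _)
    (by
      simp only [Fin.sum_univ_three, Matrix.cons_val]
      have : a * r / p + b * r / q + c * r / s = r * (a / p + b / q + c / s) := by ring
      rw [this, habc]
      field_simp)
    (by
      intro i _
      fin_cases i <;> simp <;> positivity)
  simp only [Fin.prod_univ_three, Matrix.cons_val, ← ENNReal.rpow_mul] at key
  have e1 : p * (a * r / p) = a * r := by field_simp
  have e2 : q * (b * r / q) = b * r := by field_simp
  have e3 : s * (c * r / s) = c * r := by field_simp
  rw [e1, e2, e3] at key
  have hcancel : ∀ x y : ℝ, x * r / y * (1 / r) = 1 / y * x := fun x y => by field_simp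
  rw [eLpNorm_ofReal_eq_lintegral hr, eLpNorm_ofReal_eq_lintegral hp,
    eLpNorm_ofReal_eq_lintegral hq, eLpNorm_ofReal_eq_lintegral hs]
  simp only [← ENNReal.rpow_mul]
  calc (∫⁻ x, ‖F x‖ₑ ^ r ∂μ) ^ (1 / r)
      ≤ (∫⁻ x, K ^ r * (‖f x‖ₑ ^ (a * r) * ‖g x‖ₑ ^ (b * r) * ‖h x‖ₑ ^ (c * r)) ∂μ) ^ (1 / r) := by
        gcongr with x
        refine (ENNReal.rpow_le_rpow (hF x) hr.le).trans_eq ?_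
        simp only [ENNReal.mul_rpow_of_nonneg _ _ hr.le, ENNReal.rpow_mul]
    _ = (K ^ r * ∫⁻ x, ‖f x‖ₑ ^ (a * r) * ‖g x‖ₑ ^ (b * r) * ‖h x‖ₑ ^ (c * r) ∂μ) ^ (1 / r) := by
        rw [lintegral_const_mul'']
        exact ((hf.enorm.pow_const _).mul (hg.enorm.pow_const _)).mul (hh.enorm.pow_const _)
    _ ≤ _ := by
        refine (ENNReal.rpow_le_rpow (mul_le_mul_right key _)
          (by positivity : 0 ≤ 1 / r)).trans_eq ?_
        simp only [ENNReal.mul_rpow_of_nonneg _ _ (by positivity : 0 ≤ 1 / r),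
          ← ENNReal.rpow_mul]
        rw [mul_one_div_cancel hr.ne', ENNReal.rpow_one, hcancel a p, hcancel b q, hcancel c s]

lemma eLpNorm_le_of_le_of_le {f : X → E} (hf : AEStronglyMeasurable f μ) {p r q : ℝ} (hp : 0 < p)
    (hpr : p ≤ r) (hrq : r ≤ q) {A : ℝ≥0∞} (hA : eLpNorm f (ENNReal.ofReal p) μ ≤ A)
    (hA' : eLpNorm f (ENNReal.ofReal q) μ ≤ A) : eLpNorm f (ENNReal.ofReal r) μ ≤ A := by
  have hr : 0 < r := hp.trans_le hpr
  have hq : 0 < q := hr.trans_le hrq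
  obtain rfl | hlt := eq_or_lt_of_le (hpr.trans hrq)
  · rwa [le_antisymm hrq hpr]
  have hd : 0 < 1 / p - 1 / q := sub_pos.2 (one_div_lt_one_div_of_lt hp hlt)
  set t : ℝ := (1 / r - 1 / q) / (1 / p - 1 / q) with ht
  have ht0 : 0 ≤ t := div_nonneg (sub_nonneg.2 (one_div_le_one_div_of_le hr hrq)) hd.le
  have ht1 : t ≤ 1 := (div_le_one hd).2 (by linarith [one_div_le_one_div_of_le hp hpr])
  have hte : t * (1 / p - 1 / q) = 1 / r - 1 / q := by rw [ht]; field_simp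
  have := eLpNorm_le_of_enorm_le_rpow_mul (F := f) hf hf hf hr hp hq hq ht0
    (sub_nonneg.2 ht1) le_rfl
    (by
      have : t / p + (1 - t) / q + 0 / q = t * (1 / p - 1 / q) + 1 / q := by ring
      rw [this, hte]; ring) (K := 1)
    (fun x => by
      rw [← ENNReal.rpow_add_of_nonneg _ _ ht0 (sub_nonneg.2 ht1)]
      simp)
  refine this.trans ?_
  calc 1 * (eLpNorm f (ENNReal.ofReal p) μ ^ t * eLpNorm f (ENNReal.ofReal q) μ ^ (1 - t) *
        eLpNorm f (ENNReal.ofReal q) μ ^ (0 : ℝ)) ≤ A ^ t * A ^ (1 - t) := by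
        simp only [ENNReal.rpow_zero, one_mul, mul_one]
        gcongr
    _ = A := by rw [← ENNReal.rpow_add_of_nonneg _ _ ht0 (sub_nonneg.2 ht1)]; simp

end Holder

section PowerNonlinearity

lemma rpow_sub_rpow_le_mul {p x y : ℝ} (hp : 1 ≤ p) (hy : 0 ≤ y) (hyx : y ≤ x) :
    x ^ p - y ^ p ≤ p * x ^ (p - 1) * (x - y) := by
  obtain rfl | hx := (hy.trans hyx).eq_or_lt
  · simp [le_antisymm hyx hy]
  have h := one_add_mul_self_le_rpow_one_add (s := y / x - 1)
    (by linarith [div_nonneg hy hx.le]) hp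
  rw [add_sub_cancel, div_rpow hy hx.le, le_div_iff₀ (by positivity)] at h
  have hxp : x ^ p = x ^ (p - 1) * x := by
    rw [← rpow_add_one hx.ne', sub_add_cancel]
  have : (1 + p * (y / x - 1)) * x ^ p = x ^ p - p * x ^ (p - 1) * (x - y) := by
    rw [hxp]; field_simp; ring
  linarith

lemma abs_rpow_sub_rpow_le {p x y m d : ℝ} (hp : 1 ≤ p) (hx : 0 ≤ x) (hy : 0 ≤ y)
    (hxm : x ≤ m) (hym : y ≤ m) (hd : |x - y| ≤ d) :
    |x ^ p - y ^ p| ≤ p * m ^ (p - 1) * d := by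
  wlog h : y ≤ x generalizing x y
  · rw [abs_sub_comm]
    exact this hy hx hym hxm (by rwa [abs_sub_comm]) (le_of_not_ge h)
  rw [abs_of_nonneg (sub_nonneg.2 (rpow_le_rpow hy h (by linarith)))]
  have hm : 0 ≤ m := hx.trans hxm
  have hxy : x - y ≤ d := (le_abs_self _).trans hd
  refine (rpow_sub_rpow_le_mul hp hy h).trans ?_
  gcongr

lemma norm_rpow_smul_sub_le {E : Type*} [NormedAddCommGroup E] [NormedSpace ℝ E] {σ m : ℝ}
    (hσ : 1 ≤ σ) {a b : E} (ha : ‖a‖ ≤ m) (hb : ‖b‖ ≤ m) :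
    ‖‖a‖ ^ (σ - 1) • a - ‖b‖ ^ (σ - 1) • b‖ ≤ (σ + 1) * m ^ (σ - 1) * ‖a - b‖ := by
  wlog h : ‖b‖ ≤ ‖a‖ generalizing a b
  · rw [norm_sub_rev, norm_sub_rev a]
    exact this hb ha (le_of_not_ge h)
  have hs : 0 ≤ σ - 1 := by linarith
  have h1 : ‖a‖ ^ (σ - 1) • a - ‖b‖ ^ (σ - 1) • b
      = ‖a‖ ^ (σ - 1) • (a - b) + (‖a‖ ^ (σ - 1) - ‖b‖ ^ (σ - 1)) • b := by
    rw [smul_sub, sub_smul]; abel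
  have hpow : ∀ x : ℝ, 0 ≤ x → x ^ (σ - 1) * x = x ^ σ := fun x hx => by
    nth_rewrite 2 [← rpow_one x]
    rw [← rpow_add_of_nonneg hx hs zero_le_one, sub_add_cancel]
  have hab : ‖a‖ - ‖b‖ ≤ ‖a - b‖ := norm_sub_norm_le a b
  have h2 : (‖a‖ ^ (σ - 1) - ‖b‖ ^ (σ - 1)) * ‖b‖ ≤ σ * ‖a‖ ^ (σ - 1) * ‖a - b‖ := by
    calc (‖a‖ ^ (σ - 1) - ‖b‖ ^ (σ - 1)) * ‖b‖
        = ‖a‖ ^ (σ - 1) * ‖b‖ - ‖b‖ ^ σ := by rw [sub_mul, hpow _ (norm_nonneg _)]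
      _ ≤ ‖a‖ ^ (σ - 1) * ‖a‖ - ‖b‖ ^ σ := by gcongr
      _ = ‖a‖ ^ σ - ‖b‖ ^ σ := by rw [hpow _ (norm_nonneg _)]
      _ ≤ σ * ‖a‖ ^ (σ - 1) * (‖a‖ - ‖b‖) := rpow_sub_rpow_le_mul hσ (norm_nonneg _) h
      _ ≤ _ := by gcongr
  have h3 : ‖b‖ ^ (σ - 1) ≤ ‖a‖ ^ (σ - 1) := rpow_le_rpow (norm_nonneg _) h hs
  rw [h1]
  calc _ ≤ ‖a‖ ^ (σ - 1) * ‖a - b‖ + (‖a‖ ^ (σ - 1) - ‖b‖ ^ (σ - 1)) * ‖b‖ := by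
        refine (norm_add_le _ _).trans_eq ?_
        rw [norm_smul, norm_smul, Real.norm_of_nonneg (by positivity),
          Real.norm_of_nonneg (sub_nonneg.2 h3)]
    _ ≤ (σ + 1) * ‖a‖ ^ (σ - 1) * ‖a - b‖ := by linarith
    _ ≤ _ := by gcongr

end PowerNonlinearity

section Sobolev

/-- The Gagliardo–Nirenberg–Sobolev inequality for functions in `L^p` without compact support. -/
lemma exists_eLpNorm_le_eLpNorm_fderiv_of_memLp
    {V F : Type*} [NormedAddCommGroup V] [InnerProductSpace ℝ V] [FiniteDimensional ℝ V]
    [MeasurableSpace V] [BorelSpace V] (μ : Measure V) [μ.IsAddHaarMeasure]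
    [NormedAddCommGroup F] [NormedSpace ℝ F] [FiniteDimensional ℝ F]
    {p p' : ℝ≥0} (hp : 1 ≤ p) (hV : 0 < Module.finrank ℝ V)
    (hp' : (p' : ℝ)⁻¹ = p⁻¹ - (Module.finrank ℝ V : ℝ)⁻¹) :
    ∃ C : ℝ≥0, ∀ u : V → F, ContDiff ℝ 1 u → MemLp u p μ →
      eLpNorm u p' μ ≤ C * eLpNorm (fderiv ℝ u) p μ := by
  refine ⟨SNormLESNormFDerivOfEqConst F μ p, fun u hu hup => ?_⟩
  set C : ℝ≥0 := SNormLESNormFDerivOfEqConst F μ p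
  let φ : ContDiffBump (0 : V) := ⟨1, 2, one_pos, one_lt_two⟩
  have hφ : ContDiff ℝ 1 φ := φ.contDiff
  obtain ⟨M, hM⟩ := (φ.hasCompactSupport.fderiv (𝕜 := ℝ)).exists_bound_of_continuous
    (hφ.continuous_fderiv one_ne_zero)
  have hM0 : 0 ≤ M := (norm_nonneg _).trans (hM 0)
  let c : ℕ → ℝ := fun n => ((n : ℝ) + 1)⁻¹
  have hc0 : ∀ n, 0 < c n := fun n => by positivity
  let χ : ℕ → V → ℝ := fun n x => φ (c n • x)
  have hχ : ∀ n, ContDiff ℝ 1 (χ n) := fun n => hφ.comp (contDiff_const_smul (c n))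
  have hχs : ∀ n, HasCompactSupport (χ n) := fun n =>
    φ.hasCompactSupport.comp_homeomorph (Homeomorph.smulOfNeZero (c n) (hc0 n).ne')
  have hχd : ∀ n x, ‖fderiv ℝ (χ n) x‖ ≤ c n * M := fun n x => by
    have h1 : fderiv ℝ (χ n) x = c n • fderiv ℝ φ (c n • x) := fderiv_comp_smul (c n)
    rw [h1, norm_smul, Real.norm_of_nonneg (hc0 n).le]
    exact mul_le_mul_of_nonneg_left (hM _) (hc0 n).le
  have hud : AEStronglyMeasurable (fderiv ℝ u) μ :=
    (hu.continuous_fderiv one_ne_zero).aestronglyMeasurable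
  have hclim : Tendsto c atTop (𝓝 0) := tendsto_inv_atTop_zero.comp
    (tendsto_atTop_add_const_right _ _ tendsto_natCast_atTop_atTop)
  have hbound : ∀ n, eLpNorm (fun x => χ n x • u x) p' μ ≤
      C * (eLpNorm (fderiv ℝ u) p μ + ENNReal.ofReal (c n * M) * eLpNorm u p μ) := fun n => by
    refine (eLpNorm_le_eLpNorm_fderiv_of_eq μ ((hχ n).smul hu) ((hχs n).smul_right) hp
      hV hp').trans ?_
    refine mul_le_mul_right ?_ _
    calc eLpNorm (fderiv ℝ fun x => χ n x • u x) p μ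
        ≤ eLpNorm (fun x => ‖fderiv ℝ u x‖ + (c n * M) * ‖u x‖) p μ := by
          refine eLpNorm_mono_real fun x => ?_
          rw [fderiv_fun_smul ((hχ n).differentiable one_ne_zero x)
            (hu.differentiable one_ne_zero x)]
          refine (norm_add_le _ _).trans (add_le_add ?_ ?_)
          · rw [norm_smul, Real.norm_of_nonneg φ.nonneg]
            exact mul_le_of_le_one_left (norm_nonneg _) φ.le_one
          · rw [ContinuousLinearMap.norm_smulRight_apply]
            exact mul_le_mul_of_nonneg_right (hχd n x) (norm_nonneg _)
      _ ≤ eLpNorm (fun x => ‖fderiv ℝ u x‖) p μ + eLpNorm (fun x => (c n * M) * ‖u x‖) p μ :=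
          eLpNorm_add_le hud.norm (hup.1.norm.const_mul _) (by exact_mod_cast hp)
      _ = _ := by
          rw [eLpNorm_norm]
          congr 1
          have := eLpNorm_const_smul (c n * M) (fun x => ‖u x‖) (p : ℝ≥0∞) μ
          rw [eLpNorm_norm, Real.enorm_of_nonneg (mul_nonneg (hc0 n).le hM0)] at this
          exact this
  have hlim : Tendsto (fun n => C * (eLpNorm (fderiv ℝ u) p μ +
      ENNReal.ofReal (c n * M) * eLpNorm u p μ)) atTop (𝓝 (C * eLpNorm (fderiv ℝ u) p μ)) := by
    refine ENNReal.Tendsto.const_mul ?_ (Or.inr ENNReal.coe_ne_top)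
    have h0 : Tendsto (fun n => ENNReal.ofReal (c n * M)) atTop (𝓝 0) := by
      simpa using ENNReal.tendsto_ofReal (hclim.mul_const M)
    simpa using tendsto_const_nhds.add (ENNReal.Tendsto.mul_const h0 (Or.inr hup.2.ne))
  have hptw : ∀ x, Tendsto (fun n => χ n x • u x) atTop (𝓝 (u x)) := fun x => by
    have h1 : Tendsto (fun n => c n • x) atTop (𝓝 0) := by
      simpa using hclim.smul_const x
    have h2 : Tendsto (fun n => χ n x) atTop (𝓝 (φ 0)) := (φ.continuous.tendsto 0).comp h1
    rw [φ.one_of_mem_closedBall (by simp [φ.rIn_pos.le])] at h2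
    simpa using h2.smul_const (u x)
  refine (Lp.eLpNorm_lim_le_liminf_eLpNorm
    (fun n => ((hχ n).smul hu).continuous.aestronglyMeasurable) u
    (Eventually.of_forall hptw)).trans ?_
  rw [← hlim.liminf_eq]
  exact liminf_le_liminf (Eventually.of_forall hbound)

lemma eLpNorm_ofReal_natCast_le_of_contDiff {C : ℝ≥0}
    (hC : ∀ u : EuclideanSpace ℝ (Fin 2) → ℝ, ContDiff ℝ 1 u → MemLp u 1 →
      eLpNorm u 2 ≤ C * eLpNorm (fderiv ℝ u) 1)
    (v : SchwartzMap (EuclideanSpace ℝ (Fin 2)) ℂ) (k : ℕ) (hk : 1 ≤ k) :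
    eLpNorm v (ENNReal.ofReal (2 * (k + 1))) ^ ((k : ℝ) + 1) ≤
      (C * (k + 1)) * (eLpNorm v (ENNReal.ofReal (2 * k)) ^ (k : ℝ) *
        eLpNorm (fderiv ℝ v) 2) := by
  have hk' : (1 : ℝ) ≤ k := by exact_mod_cast hk
  have hk0 : (0 : ℝ) < k := by linarith
  have hv : ContDiff ℝ 1 v := v.smooth 1
  have hvm : AEStronglyMeasurable v (volume : Measure (EuclideanSpace ℝ (Fin 2))) :=
    v.continuous.aestronglyMeasurable
  have hdm : AEStronglyMeasurable (fderiv ℝ v) (volume : Measure (EuclideanSpace ℝ (Fin 2))) :=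
    (hv.continuous_fderiv one_ne_zero).aestronglyMeasurable
  let w : EuclideanSpace ℝ (Fin 2) → ℝ := fun x => ‖v x‖ ^ ((k : ℝ) + 1)
  have hw : ContDiff ℝ 1 w := hv.norm_rpow (by linarith)
  have hwe : ∀ x, ‖w x‖ₑ = ‖v x‖ₑ ^ ((k : ℝ) + 1) := fun x => by
    simp only [w]
    rw [Real.enorm_rpow_of_nonneg (norm_nonneg _) (by positivity), enorm_norm]
  have hw1 : MemLp w 1 := by
    refine ⟨hw.continuous.aestronglyMeasurable, ?_⟩
    have h := eLpNorm_le_of_enorm_le_rpow_mul (F := w) hvm hvm hvm one_pos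
      (p := (k : ℝ) + 1) (q := 1) (s := 1) (a := (k : ℝ) + 1) (b := 0) (c := 0)
      (by positivity) one_pos one_pos (by positivity) le_rfl le_rfl
      (by field_simp; simp) (K := 1) (fun x => by rw [hwe x]; simp)
    have hfin : eLpNorm v (ENNReal.ofReal ((k : ℝ) + 1)) ≠ ∞ :=
      (v.memLp (ENNReal.ofReal ((k : ℝ) + 1)) volume).eLpNorm_ne_top
    rw [ENNReal.ofReal_one] at h
    refine h.trans_lt ?_
    simp only [ENNReal.rpow_zero, one_mul, mul_one]
    exact ENNReal.rpow_lt_top_of_nonneg (by positivity) hfin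
  have hl : eLpNorm v (ENNReal.ofReal (2 * (k + 1))) ^ ((k : ℝ) + 1) = eLpNorm w 2 := by
    have h2 : eLpNorm w 2 = eLpNorm w (ENNReal.ofReal 2) := by rw [ENNReal.ofReal_ofNat]
    rw [h2, eLpNorm_ofReal_eq_lintegral two_pos, eLpNorm_ofReal_eq_lintegral (by positivity),
      ← ENNReal.rpow_mul]
    simp only [hwe, ← ENNReal.rpow_mul]
    rw [mul_comm 2 ((k : ℝ) + 1)]
    congr 1
    field_simp
  rw [hl]
  refine (hC w hw hw1).trans ?_
  rw [mul_assoc]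
  refine mul_le_mul_right ?_ _
  have hK : ((k : ℝ≥0∞) + 1) = (((k : ℝ≥0) + 1 : ℝ≥0) : ℝ≥0∞) := by push_cast; rfl
  have h := eLpNorm_le_of_enorm_le_rpow_mul (F := fderiv ℝ w) hvm hdm hvm one_pos
      (p := 2 * k) (q := 2) (s := 1) (a := k) (b := 1) (c := 0)
      (by positivity) two_pos one_pos (by positivity) zero_le_one le_rfl
      (by field_simp; norm_num) (K := (k : ℝ≥0∞) + 1) (fun x => by
        have := enorm_fderiv_norm_rpow_le (hv.differentiable one_ne_zero) (x := x)
          (p := (k : ℝ≥0) + 1) (by simpa using Nat.pos_of_ne_zero (by lia))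
        rw [hK]
        simpa [w, mul_assoc] using this)
  simpa using h

lemma exists_eLpNorm_le_of_dim_two (k : ℕ) (hk : 1 ≤ k) :
    ∃ C : ℝ≥0, ∀ (v : SchwartzMap (EuclideanSpace ℝ (Fin 2)) ℂ) (A : ℝ≥0∞),
      eLpNorm v 2 ≤ A → eLpNorm (fderiv ℝ v) 2 ≤ A →
      eLpNorm v (ENNReal.ofReal (2 * k)) ≤ C * A := by
  obtain ⟨C₀, hC₀⟩ : ∃ C : ℝ≥0, ∀ u : EuclideanSpace ℝ (Fin 2) → ℝ, ContDiff ℝ 1 u → MemLp u 1 →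
      eLpNorm u 2 ≤ C * eLpNorm (fderiv ℝ u) 1 := exists_eLpNorm_le_eLpNorm_fderiv_of_memLp
    (volume : Measure (EuclideanSpace ℝ (Fin 2))) (F := ℝ)
    (p := 1) (p' := 2) le_rfl (by simp) (by simp; norm_num)
  induction k, hk using Nat.le_induction with
  | base => exact ⟨1, fun v A h _ => by simpa using h⟩
  | succ k hk ih =>
    obtain ⟨C, hC⟩ := ih
    have hk0 : (0 : ℝ) ≤ k := k.cast_nonneg
    have hk1 : (0 : ℝ) < (k : ℝ) + 1 := by positivity
    let D : ℝ≥0 := (C₀ * (k + 1) * C ^ (k : ℝ)) ^ (((k : ℝ) + 1)⁻¹)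
    have hD : (D : ℝ≥0∞) ^ ((k : ℝ) + 1) = C₀ * ((k : ℝ≥0∞) + 1) * (C : ℝ≥0∞) ^ (k : ℝ) := by
      rw [← ENNReal.coe_rpow_of_nonneg _ hk1.le, ← NNReal.rpow_mul, inv_mul_cancel₀ hk1.ne',
        NNReal.rpow_one, ← ENNReal.coe_rpow_of_nonneg _ hk0]
      push_cast
      rfl
    refine ⟨D, fun v A h h' => ?_⟩
    have key : eLpNorm v (ENNReal.ofReal (2 * ((k : ℝ) + 1))) ^ ((k : ℝ) + 1) ≤
        ((D : ℝ≥0∞) * A) ^ ((k : ℝ) + 1) := by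
      rw [ENNReal.mul_rpow_of_nonneg _ _ hk1.le, hD,
        ENNReal.rpow_add_of_nonneg (x := A) _ _ hk0 zero_le_one, ENNReal.rpow_one]
      have h1 : eLpNorm v (ENNReal.ofReal (2 * k)) ^ (k : ℝ) ≤
          (C : ℝ≥0∞) ^ (k : ℝ) * A ^ (k : ℝ) := by
        rw [← ENNReal.mul_rpow_of_nonneg _ _ hk0]
        exact ENNReal.rpow_le_rpow (hC v A h h') hk0
      refine (eLpNorm_ofReal_natCast_le_of_contDiff hC₀ v k hk).trans
        ((mul_le_mul_right (mul_le_mul' h1 h') _).trans_eq ?_)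
      ring
    rw [ENNReal.rpow_le_rpow_iff hk1] at key
    rwa [Nat.cast_add, Nat.cast_one]

lemma SchwartzMap.enorm_le_of_eLpNorm_deriv_le (g : SchwartzMap ℝ ℂ) {A : ℝ≥0∞}
    (h : eLpNorm g 2 ≤ A) (h' : eLpNorm (deriv g) 2 ≤ A) (t : ℝ) : ‖g t‖ₑ ≤ 2 * A := by
  obtain rfl | hA := eq_or_ne A ∞
  · simp
  have hg : ContDiff ℝ 1 g := g.smooth 1
  have hgd : Continuous (deriv g) := hg.continuous_deriv le_rfl
  let w' : ℝ → ℝ := fun t => 2 * inner ℝ (g t) (deriv g t)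
  have hw : ∀ t, HasDerivAt (fun t => ‖g t‖ ^ 2) (w' t) t := fun t =>
    ((hg.differentiable one_ne_zero t).hasDerivAt).norm_sq
  have hw'c : Continuous w' := continuous_const.mul (hg.continuous.inner hgd)
  have hw'1 : eLpNorm w' 1 ≤ 2 * (A * A) := by
    have := eLpNorm_le_of_enorm_le_rpow_mul (F := w') (r := 1) (p := 2) (q := 2) (s := 1)
      (a := 1) (b := 1) (c := 0) (μ := volume)
      hg.continuous.aestronglyMeasurable hgd.aestronglyMeasurable hgd.aestronglyMeasurable
      one_pos two_pos two_pos one_pos zero_le_one zero_le_one le_rfl (by norm_num) (K := 2)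
      (fun t => by
        have h1 : ‖w' t‖ ≤ 2 * (‖g t‖ * ‖deriv g t‖) := by
          simp only [w', norm_mul, Real.norm_ofNat]
          gcongr
          exact norm_inner_le_norm _ _
        rw [← ofReal_norm, ← ofReal_norm (g t), ← ofReal_norm (deriv g t)]
        refine (ENNReal.ofReal_le_ofReal h1).trans_eq ?_
        rw [ENNReal.ofReal_mul two_pos.le, ENNReal.ofReal_mul (norm_nonneg _)]
        simp)
    simp only [ENNReal.ofReal_one, ENNReal.ofReal_ofNat, ENNReal.rpow_one, ENNReal.rpow_zero,
      mul_one] at this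
    exact this.trans (by gcongr)
  have hint : Integrable w' := memLp_one_iff_integrable.1
    ⟨hw'c.aestronglyMeasurable, hw'1.trans_lt (by finiteness)⟩
  have hlim : Tendsto (fun t => ‖g t‖ ^ 2) atBot (𝓝 0) := by
    have := (zero_at_infty g).mono_left atBot_le_cocompact
    simpa using this.norm.pow 2
  have hFTC := integral_Iic_of_hasDerivAt_of_tendsto' (a := t) (fun t _ => hw t)
    hint.integrableOn hlim
  rw [sub_zero] at hFTC
  rw [eLpNorm_one_eq_lintegral_enorm] at hw'1
  have h1 : ‖g t‖ₑ ^ 2 ≤ ∫⁻ t in Iic t, ‖w' t‖ₑ := by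
    rw [← enorm_norm (g t), ← enorm_pow, ← hFTC]
    exact enorm_integral_le_lintegral_enorm w'
  have h2 : ‖g t‖ₑ ^ 2 ≤ (2 * A) ^ 2 := by
    refine (h1.trans ((setLIntegral_le_lintegral (Iic t) fun t => ‖w' t‖ₑ).trans hw'1)).trans ?_
    have h4 : (2 * A) ^ 2 = 2 * (A * A) + 2 * (A * A) := by ring
    rw [h4]
    exact le_self_add
  exact (ENNReal.pow_le_pow_left_iff two_ne_zero).1 h2

lemma enorm_le_of_dim_one (v : SchwartzMap (EuclideanSpace ℝ (Fin 1)) ℂ) {A : ℝ≥0∞}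
    (h : eLpNorm v 2 ≤ A) (h' : eLpNorm (fderiv ℝ v) 2 ≤ A) (x : EuclideanSpace ℝ (Fin 1)) :
    ‖v x‖ₑ ≤ 2 * A := by
  let e : ℝ ≃ₗᵢ[ℝ] EuclideanSpace ℝ (Fin 1) := (OrthonormalBasis.singleton (Fin 1) ℝ).repr
  let g : SchwartzMap ℝ ℂ :=
    SchwartzMap.compCLMOfContinuousLinearEquiv ℝ e.toContinuousLinearEquiv v
  have hge : ⇑g = v ∘ e := rfl
  have hmp : MeasurePreserving e volume volume := e.measurePreserving
  have hg : eLpNorm g 2 ≤ A := by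
    rw [hge, eLpNorm_comp_measurePreserving v.continuous.aestronglyMeasurable hmp]
    exact h
  have hg' : eLpNorm (deriv g) 2 ≤ A := by
    rw [← eLpNorm_comp_measurePreserving
      ((v.smooth 1).continuous_fderiv one_ne_zero).aestronglyMeasurable hmp] at h'
    refine (eLpNorm_mono fun t => ?_).trans h'
    rw [norm_deriv_eq_norm_fderiv, hge]
    have : fderiv ℝ (v ∘ e) t = (fderiv ℝ v (e t)).comp
        (e.toContinuousLinearEquiv : ℝ →L[ℝ] EuclideanSpace ℝ (Fin 1)) :=
      e.toContinuousLinearEquiv.comp_right_fderiv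
    rw [this]
    refine (ContinuousLinearMap.opNorm_comp_le _ _).trans
      (mul_le_of_le_one_right (norm_nonneg _) ?_)
    exact e.toLinearIsometry.norm_toContinuousLinearMap_le
  simpa [hge] using g.enorm_le_of_eLpNorm_deriv_le hg hg' (e.symm x)

lemma exists_eLpNorm_le_eLpNorm_fderiv_two (N : ℕ) (hN : 2 < N)
    {F : Type*} [NormedAddCommGroup F] [NormedSpace ℝ F] [FiniteDimensional ℝ F] :
    ∃ C : ℝ≥0, ∀ v : SchwartzMap (EuclideanSpace ℝ (Fin N)) F,
      eLpNorm v (ENNReal.ofReal (2 * N / ((N : ℝ) - 2))) ≤ C * eLpNorm (fderiv ℝ v) 2 := by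
  have hN' : (0 : ℝ) < (N : ℝ) - 2 := sub_pos.2 (by exact_mod_cast hN)
  have hN0 : (0 : ℝ) < N := by linarith
  have hq : (0 : ℝ) ≤ 2 * N / ((N : ℝ) - 2) := by positivity
  obtain ⟨C, hC⟩ := exists_eLpNorm_le_eLpNorm_fderiv_of_memLp
    (volume : Measure (EuclideanSpace ℝ (Fin N))) (F := F) (p := 2)
    (p' := (2 * N / ((N : ℝ) - 2)).toNNReal) one_le_two (by simp; lia) (by
      rw [Real.coe_toNNReal _ hq, finrank_euclideanSpace_fin]
      push_cast
      field_simp)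
  exact ⟨C, fun v => hC v (v.smooth 1) (v.memLp _ _)⟩

/-- The Sobolev embedding of `H¹` into `L^r`. -/
lemma exists_eLpNorm_le_of_eLpNorm_fderiv_le (N : ℕ) (hN : 1 ≤ N) {r : ℝ} (hr : 2 ≤ r)
    (hr' : 2 < N → r ≤ 2 * N / ((N : ℝ) - 2)) :
    ∃ C : ℝ≥0, ∀ (v : SchwartzMap (EuclideanSpace ℝ (Fin N)) ℂ) (A : ℝ≥0∞),
      eLpNorm v 2 ≤ A → eLpNorm (fderiv ℝ v) 2 ≤ A → eLpNorm v (ENNReal.ofReal r) ≤ C * A := by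
  have hr0 : 0 < r := by linarith
  have interp : ∀ (v : SchwartzMap (EuclideanSpace ℝ (Fin N)) ℂ) (A : ℝ≥0∞) (C : ℝ≥0) (q : ℝ),
      r ≤ q → eLpNorm v 2 ≤ A → eLpNorm v (ENNReal.ofReal q) ≤ C * A →
      eLpNorm v (ENNReal.ofReal r) ≤ (C + 1 : ℝ≥0) * A := fun v A C q hrq h h' => by
    refine eLpNorm_le_of_le_of_le v.continuous.aestronglyMeasurable two_pos hr hrq ?_ ?_
    · rw [ENNReal.ofReal_ofNat, ENNReal.coe_add, add_mul, ENNReal.coe_one, one_mul]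
      exact h.trans le_add_self
    · rw [ENNReal.coe_add, add_mul]
      exact h'.trans le_self_add
  obtain hN3 | hN3 := lt_or_ge 2 N
  · obtain ⟨C, hC⟩ := exists_eLpNorm_le_eLpNorm_fderiv_two N hN3 (F := ℂ)
    exact ⟨C + 1, fun v A h h' => interp v A C _ (hr' hN3) h
      ((hC v).trans (mul_le_mul_right h' _))⟩
  obtain rfl | rfl : N = 1 ∨ N = 2 := by lia
  · refine ⟨2, fun v A h h' => ?_⟩
    have hvm : AEStronglyMeasurable v (volume : Measure (EuclideanSpace ℝ (Fin 1))) :=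
      v.continuous.aestronglyMeasurable
    have ht0 : 0 ≤ 2 / r := by positivity
    have ht1 : 0 ≤ 1 - 2 / r := sub_nonneg.2 ((div_le_one hr0).2 hr)
    have := eLpNorm_le_of_enorm_le_rpow_mul (F := v) hvm hvm hvm hr0 (p := 2) (q := 1) (s := 1)
      (a := 2 / r) (b := 0) (c := 0) two_pos one_pos one_pos ht0 le_rfl le_rfl
      (by field_simp; simp) (K := (2 * A) ^ (1 - 2 / r)) (fun x => by
        simp only [ENNReal.rpow_zero, mul_one]
        calc ‖v x‖ₑ = ‖v x‖ₑ ^ (1 - 2 / r) * ‖v x‖ₑ ^ (2 / r) := by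
              rw [← ENNReal.rpow_add_of_nonneg _ _ ht1 ht0]; simp
          _ ≤ _ := by
              gcongr
              exact enorm_le_of_dim_one v h h' x)
    simp only [ENNReal.rpow_zero, mul_one, ENNReal.ofReal_ofNat] at this
    refine this.trans ?_
    have hA : eLpNorm v 2 ≤ 2 * A := h.trans (by rw [two_mul]; exact le_self_add)
    refine (mul_le_mul_right (ENNReal.rpow_le_rpow hA ht0) _).trans ?_
    rw [← ENNReal.rpow_add_of_nonneg _ _ ht1 ht0, sub_add_cancel, ENNReal.rpow_one,
      ENNReal.coe_ofNat]
  · have hk : 1 ≤ ⌈r⌉₊ := Nat.one_le_iff_ne_zero.2 (Nat.ceil_pos.2 hr0).ne'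
    obtain ⟨C, hC⟩ := exists_eLpNorm_le_of_dim_two ⌈r⌉₊ hk
    exact ⟨C + 1, fun v A h h' => interp v A C _
      (by linarith [Nat.le_ceil r]) h (hC v A h h')⟩

end Sobolev

section Elliptic

open scoped LineDeriv

lemma ENNReal.le_sq_div_mul_of_mul_sq_le {A C X Y c : ℝ≥0∞} (hX : X ≠ ∞) (hc : c ≠ 0)
    (hc' : c ≠ ∞) (h : c * X ^ 2 ≤ A * Y) (hY : Y ≤ C * X) : Y ≤ C ^ 2 / c * A := by
  obtain rfl | hX0 := eq_or_ne X 0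
  · rw [mul_zero] at hY
    exact hY.trans zero_le
  have h2 : c * X ≤ A * C := by
    rw [← ENNReal.mul_le_mul_iff_left hX0 hX]
    calc c * X * X = c * X ^ 2 := by ring
      _ ≤ A * (C * X) := h.trans (by gcongr)
      _ = A * C * X := by ring
  have h3 : X ≤ A * C / c := by
    rwa [ENNReal.le_div_iff_mul_le (Or.inl hc) (Or.inl hc'), mul_comm]
  calc Y ≤ C * (A * C / c) := hY.trans (by gcongr)
    _ = C ^ 2 / c * A := by simp only [div_eq_mul_inv]; ring

lemma sq_eLpNorm_two_eq_ofReal_integral {X E : Type*} [MeasurableSpace X] {μ : Measure X}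
    [NormedAddCommGroup E] {f : X → E} (hf : MemLp f 2 μ) :
    eLpNorm f 2 μ ^ 2 = ENNReal.ofReal (∫ x, ‖f x‖ ^ 2 ∂μ) := by
  have h := eLpNorm_ofReal_eq_lintegral (μ := μ) two_pos f
  rw [ENNReal.ofReal_ofNat] at h
  rw [h, ← ENNReal.rpow_natCast, ← ENNReal.rpow_mul,
    ofReal_integral_eq_lintegral_ofReal (hf.integrable_norm_pow two_ne_zero)
      (ae_of_all _ fun x => by positivity)]
  simp [ENNReal.ofReal_pow]

lemma sq_norm_eq_sum_sq_apply_basisVec {N : ℕ} (L : EuclideanSpace ℝ (Fin N) →L[ℝ] ℝ) :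
    ‖L‖ ^ 2 = ∑ i, L (basisVec N i) ^ 2 := by
  rw [← (InnerProductSpace.toDual ℝ _).symm.norm_map L, EuclideanSpace.norm_sq_eq]
  refine Finset.sum_congr rfl fun i _ => ?_
  have := InnerProductSpace.toDual_symm_apply (x := basisVec N i) (y := L)
  rw [← this, real_inner_comm, basisVec, EuclideanSpace.inner_single_left]
  simp

variable {N : ℕ}

lemma SchwartzMap.integrable_mul (f g : SchwartzMap (EuclideanSpace ℝ (Fin N)) ℝ) :
    Integrable (fun x => f x * g x) :=
  (f.memLp 2).integrable_mul (g.memLp 2)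

lemma SchwartzMap.memLp_fderiv {F : Type*} [NormedAddCommGroup F] [NormedSpace ℝ F]
    (v : SchwartzMap (EuclideanSpace ℝ (Fin N)) F) (p : ℝ≥0∞) :
    MemLp (fderiv ℝ v) p :=
  (SchwartzMap.fderivCLM ℝ _ _ v).memLp p volume

lemma lap_eq_sum_lineDeriv (w : SchwartzMap (EuclideanSpace ℝ (Fin N)) ℝ)
    (x : EuclideanSpace ℝ (Fin N)) :
    lap N w x = ∑ i, (∂_{basisVec N i} (∂_{basisVec N i} w)) x := rfl

/-- The energy identity for `w - α² Δ w`. -/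
lemma integral_sub_lap_mul_self (α : ℝ) (w : SchwartzMap (EuclideanSpace ℝ (Fin N)) ℝ) :
    ∫ x, (w x - α ^ 2 * lap N w x) * w x =
      (∫ x, ‖w x‖ ^ 2) + α ^ 2 * ∫ x, ‖fderiv ℝ w x‖ ^ 2 := by
  have h1 : ∀ x, (w x - α ^ 2 * lap N w x) * w x =
      w x * w x - α ^ 2 * ∑ i, w x * (∂_{basisVec N i} (∂_{basisVec N i} w)) x := fun x => by
    rw [lap_eq_sum_lineDeriv, ← Finset.mul_sum]
    ring
  have h2 : ∀ x, ‖fderiv ℝ w x‖ ^ 2 =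
      ∑ i, (∂_{basisVec N i} w) x * (∂_{basisVec N i} w) x := fun x => by
    rw [sq_norm_eq_sum_sq_apply_basisVec]
    exact Finset.sum_congr rfl fun i _ => sq _
  simp_rw [h1, h2, Real.norm_eq_abs, sq_abs]
  rw [integral_sub (w.integrable_mul w) ((integrable_finsetSum _ fun i _ =>
      w.integrable_mul (∂_{basisVec N i} (∂_{basisVec N i} w))).const_mul _),
    integral_const_mul,
    integral_finsetSum _ (fun i _ => w.integrable_mul (∂_{basisVec N i} (∂_{basisVec N i} w))),
    integral_finsetSum _ (fun i _ => (∂_{basisVec N i} w).integrable_mul (∂_{basisVec N i} w))]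
  simp_rw [SchwartzMap.integral_mul_lineDerivOp_right_eq_neg_left, sq, Finset.sum_neg_distrib]
  ring

lemma energy_le (α : ℝ) (w : SchwartzMap (EuclideanSpace ℝ (Fin N)) ℝ)
    {s s' : ℝ} (hs : 0 < s) (hs' : 0 < s') (hss : 1 / s + 1 / s' = 1) :
    eLpNorm w 2 ^ 2 + ENNReal.ofReal (α ^ 2) * eLpNorm (fderiv ℝ w) 2 ^ 2 ≤
      eLpNorm (fun x => w x - α ^ 2 * lap N w x) (ENNReal.ofReal s) *
        eLpNorm w (ENNReal.ofReal s') := by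
  rw [sq_eLpNorm_two_eq_ofReal_integral (w.memLp 2 volume),
    sq_eLpNorm_two_eq_ofReal_integral (w.memLp_fderiv 2), ← ENNReal.ofReal_mul (sq_nonneg α),
    ← ENNReal.ofReal_add (integral_nonneg fun x => by positivity)
      (mul_nonneg (sq_nonneg α) (integral_nonneg fun x => by positivity)),
    ← integral_sub_lap_mul_self]
  have hc : Continuous fun x => w x - α ^ 2 * lap N w x := by
    simp_rw [lap_eq_sum_lineDeriv]
    exact w.continuous.sub (continuous_const.mul (continuous_finsetSum _ fun i _ =>
      (∂_{basisVec N i} (∂_{basisVec N i} w)).continuous))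
  have key := eLpNorm_le_of_enorm_le_rpow_mul (μ := volume)
    (F := fun x => (w x - α ^ 2 * lap N w x) * w x) (r := 1) (a := 1) (b := 1) (c := 0) (K := 1)
    hc.aestronglyMeasurable w.continuous.aestronglyMeasurable w.continuous.aestronglyMeasurable
    one_pos hs hs' one_pos zero_le_one zero_le_one le_rfl (by rw [hss]; simp)
    (fun x => by simp)
  simp only [ENNReal.ofReal_one, ENNReal.rpow_one, ENNReal.rpow_zero, mul_one, one_mul] at key
  refine le_trans ?_ key
  rw [eLpNorm_one_eq_lintegral_enorm]
  refine le_trans ?_ (enorm_integral_le_lintegral_enorm _)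
  exact Real.ofReal_le_enorm _

/-- The estimate `‖w‖_{s'} ≤ K ‖w - α² Δ w‖_s` for dual exponents admitting a Sobolev embedding of
the energy space into `L^{s'}`. -/
lemma eLpNorm_le_of_energy {α s s' : ℝ} (hs : 0 < s) (hs' : 0 < s')
    (hss : 1 / s + 1 / s' = 1) {w : SchwartzMap (EuclideanSpace ℝ (Fin N)) ℝ} {C : ℝ≥0}
    {X c : ℝ≥0∞} (hX : X ≠ ∞) (hc : c ≠ 0) (hc' : c ≠ ∞)
    (hXE : c * X ^ 2 ≤ eLpNorm w 2 ^ 2 + ENNReal.ofReal (α ^ 2) * eLpNorm (fderiv ℝ w) 2 ^ 2)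
    (hC : eLpNorm w (ENNReal.ofReal s') ≤ C * X) :
    eLpNorm w (ENNReal.ofReal s') ≤
      C ^ 2 / c * eLpNorm (fun x => w x - α ^ 2 * lap N w x) (ENNReal.ofReal s) := by
  exact ENNReal.le_sq_div_mul_of_mul_sq_le hX hc hc' (hXE.trans (energy_le α w hs hs' hss)) hC

end Elliptic

section Nonlinearity

variable {N : ℕ}

lemma exists_eLpNorm_le_eLpNorm_sub_lap (hN : 2 < N) {α : ℝ} (hα : 0 < α) :
    ∃ K : ℝ≥0∞, K ≠ ∞ ∧ ∀ w : SchwartzMap (EuclideanSpace ℝ (Fin N)) ℝ,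
      eLpNorm w (ENNReal.ofReal (2 * N / ((N : ℝ) - 2))) ≤
        K * eLpNorm (fun x => w x - α ^ 2 * lap N w x)
          (ENNReal.ofReal (2 * N / ((N : ℝ) + 2))) := by
  obtain ⟨C, hC⟩ := exists_eLpNorm_le_eLpNorm_fderiv_two N hN (F := ℝ)
  have hN' : (0 : ℝ) < (N : ℝ) - 2 := sub_pos.2 (by exact_mod_cast hN)
  have hN0 : (0 : ℝ) < N := by linarith
  have hc : ENNReal.ofReal (α ^ 2) ≠ 0 := by simpa using hα.ne'
  refine ⟨C ^ 2 / ENNReal.ofReal (α ^ 2), ENNReal.div_ne_top (by finiteness) hc, fun w => ?_⟩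
  exact eLpNorm_le_of_energy (by positivity) (by positivity) (by field_simp; ring)
    (w.memLp_fderiv 2).eLpNorm_ne_top hc ENNReal.ofReal_ne_top le_add_self (hC w)

lemma eLpNorm_two_le_eLpNorm_sub_lap (α : ℝ) (w : SchwartzMap (EuclideanSpace ℝ (Fin N)) ℝ) :
    eLpNorm w (ENNReal.ofReal 2) ≤
      1 * eLpNorm (fun x => w x - α ^ 2 * lap N w x) (ENNReal.ofReal 2) := by
  have hX : eLpNorm w 2 volume ≠ ∞ := (w.memLp 2 volume).eLpNorm_ne_top
  have h := eLpNorm_le_of_energy (α := α) (w := w) (C := 1) (c := 1) (X := eLpNorm w 2 volume)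
    two_pos two_pos (by norm_num) hX one_ne_zero ENNReal.one_ne_top
    (by rw [one_mul]; exact le_self_add)
    (by rw [ENNReal.coe_one, one_mul, ENNReal.ofReal_ofNat])
  rwa [ENNReal.coe_one, one_pow, div_one] at h

/-- Dual exponents for which `1 - α² Δ` is boundedly invertible, adapted to the power `σ + 1`. -/
lemma exists_exponents (N : ℕ) {α σ : ℝ} (hα : 0 < α) (hσ : 1 ≤ σ)
    (hσ' : 2 < N → σ < 4 / ((N : ℝ) - 2)) :
    ∃ s s' : ℝ, 0 < s ∧ 0 < s' ∧ 1 / s + 1 / s' = 1 ∧ 2 < s * (σ + 1) ∧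
      (2 < N → s * (σ + 1) ≤ 2 * N / ((N : ℝ) - 2)) ∧
      ∃ K : ℝ≥0∞, K ≠ ∞ ∧ ∀ w : SchwartzMap (EuclideanSpace ℝ (Fin N)) ℝ,
        eLpNorm w (ENNReal.ofReal s') ≤
          K * eLpNorm (fun x => w x - α ^ 2 * lap N w x) (ENNReal.ofReal s) := by
  obtain hN | hN := lt_or_ge 2 N
  · have hN2 : (2 : ℝ) < N := by exact_mod_cast hN
    have hN' : (0 : ℝ) < (N : ℝ) - 2 := sub_pos.2 hN2
    have hN0 : (0 : ℝ) < N := by linarith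
    refine ⟨2 * N / ((N : ℝ) + 2), 2 * N / ((N : ℝ) - 2), by positivity, by positivity,
      by field_simp; ring, ?_, fun _ => ?_, exists_eLpNorm_le_eLpNorm_sub_lap hN hα⟩
    · rw [div_mul_eq_mul_div, lt_div_iff₀ (by positivity)]
      nlinarith
    · have h := hσ' hN
      rw [lt_div_iff₀ hN'] at h
      rw [div_mul_eq_mul_div, div_le_div_iff₀ (by positivity) hN']
      nlinarith
  · exact ⟨2, 2, two_pos, two_pos, by norm_num, by linarith, fun h => absurd h hN.not_gt, 1,
      ENNReal.one_ne_top, eLpNorm_two_le_eLpNorm_sub_lap α⟩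

lemma lap_sub (u₁ u₂ : SchwartzMap (EuclideanSpace ℝ (Fin N)) ℝ) (x : EuclideanSpace ℝ (Fin N)) :
    lap N (u₁ - u₂ : SchwartzMap (EuclideanSpace ℝ (Fin N)) ℝ) x = lap N u₁ x - lap N u₂ x := by
  simp_rw [lap_eq_sum_lineDeriv, sub_eq_add_neg, LineDeriv.lineDerivOp_add,
    LineDeriv.lineDerivOp_neg, add_apply, neg_apply, Finset.sum_add_distrib, Finset.sum_neg_distrib]

/-- The Lipschitz estimate for the nonlinearity in terms of an `L^r` bound `A`, given an elliptic
estimate with constant `K`. -/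
lemma eLpNorm_nonlinearity_sub_le {α σ s s' r r' : ℝ} (hσ : 1 ≤ σ) (hs : 0 < s) (hs' : 0 < s')
    (hr : 0 < r) (hr' : 0 < r') (hss : 1 / s + 1 / s' = 1) (hrr : 1 / r + 1 / r' = 1)
    (hsr : r = s * (σ + 1)) {K A : ℝ≥0∞}
    (hK : ∀ w : SchwartzMap (EuclideanSpace ℝ (Fin N)) ℝ, eLpNorm w (ENNReal.ofReal s') ≤
      K * eLpNorm (fun x => w x - α ^ 2 * lap N w x) (ENNReal.ofReal s))
    {v₁ v₂ : SchwartzMap (EuclideanSpace ℝ (Fin N)) ℂ}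
    {u₁ u₂ : SchwartzMap (EuclideanSpace ℝ (Fin N)) ℝ}
    (h₁ : ∀ x, u₁ x - α ^ 2 * lap N u₁ x = ‖v₁ x‖ ^ (σ + 1))
    (h₂ : ∀ x, u₂ x - α ^ 2 * lap N u₂ x = ‖v₂ x‖ ^ (σ + 1))
    (hA : eLpNorm (fun x => ‖v₁ x‖ + ‖v₂ x‖) (ENNReal.ofReal r) ≤ A) :
    eLpNorm (fun x => (u₁ x : ℂ) * ((‖v₁ x‖ ^ (σ - 1) : ℝ) : ℂ) * v₁ x
        - (u₂ x : ℂ) * ((‖v₂ x‖ ^ (σ - 1) : ℝ) : ℂ) * v₂ x) (ENNReal.ofReal r') ≤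
      2 * K * ENNReal.ofReal (σ + 1) * (A ^ (2 * σ) *
        eLpNorm (fun x => v₁ x - v₂ x) (ENNReal.ofReal r)) := by
  have hσ0 : 0 ≤ σ := by linarith
  have hσ1 : 0 ≤ σ - 1 := by linarith
  have hσ2 : 0 ≤ σ + 1 := by linarith
  have hsr' : 1 / s = (σ + 1) / r := by rw [hsr]; field_simp
  have hr1 : 1 ≤ r' := by
    rw [← one_div_le_one_div hr' one_pos]
    linarith [one_div_pos.2 hr]
  let M : EuclideanSpace ℝ (Fin N) → ℝ := fun x => ‖v₁ x‖ + ‖v₂ x‖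
  let d : EuclideanSpace ℝ (Fin N) → ℂ := fun x => v₁ x - v₂ x
  have hM0 : ∀ x, 0 ≤ M x := fun x => by positivity
  have hv₁M : ∀ x, ‖v₁ x‖ ≤ M x := fun x => le_add_of_nonneg_right (norm_nonneg _)
  have hv₂M : ∀ x, ‖v₂ x‖ ≤ M x := fun x => le_add_of_nonneg_left (norm_nonneg _)
  have hMc : Continuous M := v₁.continuous.norm.add v₂.continuous.norm
  have hdc : Continuous d := v₁.continuous.sub v₂.continuous
  have hMm : AEStronglyMeasurable M (volume : Measure (EuclideanSpace ℝ (Fin N))) :=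
    hMc.aestronglyMeasurable
  have hdm : AEStronglyMeasurable d (volume : Measure (EuclideanSpace ℝ (Fin N))) :=
    hdc.aestronglyMeasurable
  have hum : ∀ u : SchwartzMap (EuclideanSpace ℝ (Fin N)) ℝ,
      AEStronglyMeasurable u (volume : Measure (EuclideanSpace ℝ (Fin N))) :=
    fun u => u.continuous.aestronglyMeasurable
  have hMe : ∀ (p : ℝ), 0 ≤ p → ∀ x, ENNReal.ofReal (M x ^ p) = ‖M x‖ₑ ^ p := fun p hp x => by
    rw [← ENNReal.ofReal_rpow_of_nonneg (hM0 x) hp, Real.enorm_of_nonneg (hM0 x)]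
  have hu₁ : eLpNorm u₁ (ENNReal.ofReal s') ≤ K * A ^ (σ + 1) := by
    have h := eLpNorm_le_of_enorm_le_rpow_mul (μ := volume)
      (F := fun x => u₁ x - α ^ 2 * lap N u₁ x) hMm hMm hMm hs hr hr hr (K := 1)
      (a := σ + 1) (b := 0) (c := 0) hσ2 le_rfl le_rfl (by rw [hsr']; simp) (fun x => by
        rw [h₁ x, ENNReal.rpow_zero, mul_one, mul_one, one_mul, ← hMe _ hσ2,
          Real.enorm_of_nonneg (by positivity)]
        exact ENNReal.ofReal_le_ofReal (rpow_le_rpow (norm_nonneg _) (hv₁M x) hσ2))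
    simp only [ENNReal.rpow_zero, mul_one, one_mul] at h
    exact (hK u₁).trans (mul_le_mul_right (h.trans (ENNReal.rpow_le_rpow hA hσ2)) K)
  have hu : eLpNorm (u₁ - u₂ : SchwartzMap (EuclideanSpace ℝ (Fin N)) ℝ) (ENNReal.ofReal s') ≤
      K * (ENNReal.ofReal (σ + 1) * (A ^ σ * eLpNorm d (ENNReal.ofReal r))) := by
    have h := eLpNorm_le_of_enorm_le_rpow_mul (μ := volume)
      (F := fun x => (u₁ - u₂ : SchwartzMap (EuclideanSpace ℝ (Fin N)) ℝ) x -
        α ^ 2 * lap N (u₁ - u₂ : SchwartzMap (EuclideanSpace ℝ (Fin N)) ℝ) x)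
      hMm hdm hMm hs hr hr hr (K := ENNReal.ofReal (σ + 1))
      (a := σ) (b := 1) (c := 0) hσ0 zero_le_one le_rfl (by rw [hsr']; ring) (fun x => by
        have h3 : (u₁ - u₂ : SchwartzMap (EuclideanSpace ℝ (Fin N)) ℝ) x -
            α ^ 2 * lap N (u₁ - u₂ : SchwartzMap (EuclideanSpace ℝ (Fin N)) ℝ) x =
            ‖v₁ x‖ ^ (σ + 1) - ‖v₂ x‖ ^ (σ + 1) := by
          rw [lap_sub, sub_apply, ← h₁ x, ← h₂ x]
          ring
        have h4 := abs_rpow_sub_rpow_le (p := σ + 1) (by linarith) (norm_nonneg _) (norm_nonneg _)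
          (hv₁M x) (hv₂M x) (abs_norm_sub_norm_le _ _)
        rw [add_sub_cancel_right] at h4
        rw [h3, ENNReal.rpow_zero, mul_one, ENNReal.rpow_one, ← hMe _ hσ0, ← ofReal_norm (d x),
          ← mul_assoc, ← ENNReal.ofReal_mul hσ2, ← ENNReal.ofReal_mul
            (mul_nonneg hσ2 (rpow_nonneg (hM0 x) _)), Real.enorm_eq_ofReal_abs]
        exact ENNReal.ofReal_le_ofReal h4)
    simp only [ENNReal.rpow_zero, mul_one, ENNReal.rpow_one] at h
    refine (hK (u₁ - u₂)).trans (mul_le_mul_right (h.trans ?_) K)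
    gcongr
  let g : SchwartzMap (EuclideanSpace ℝ (Fin N)) ℂ → EuclideanSpace ℝ (Fin N) → ℂ :=
    fun v x => ‖v x‖ ^ (σ - 1) • v x
  have hgc : ∀ v, Continuous (g v) := fun v =>
    (v.continuous.norm.rpow_const fun _ => Or.inr hσ1).smul v.continuous
  have hsplit : (fun x => (u₁ x : ℂ) * ((‖v₁ x‖ ^ (σ - 1) : ℝ) : ℂ) * v₁ x
        - (u₂ x : ℂ) * ((‖v₂ x‖ ^ (σ - 1) : ℝ) : ℂ) * v₂ x) =
      (fun x => u₁ x • (g v₁ x - g v₂ x)) +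
        fun x => (u₁ - u₂ : SchwartzMap (EuclideanSpace ℝ (Fin N)) ℝ) x • g v₂ x := by
    funext x
    simp only [g, Pi.add_apply, sub_apply, Complex.real_smul, Complex.ofReal_sub]
    ring
  have hb₁ : eLpNorm (fun x => u₁ x • (g v₁ x - g v₂ x)) (ENNReal.ofReal r') ≤
      ENNReal.ofReal (σ + 1) * (K * A ^ (σ + 1) * A ^ (σ - 1) *
        eLpNorm d (ENNReal.ofReal r)) := by
    have h := eLpNorm_le_of_enorm_le_rpow_mul (μ := volume)
      (F := fun x => u₁ x • (g v₁ x - g v₂ x))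
      (hum u₁) hMm hdm hr' hs' hr hr (K := ENNReal.ofReal (σ + 1))
      (a := 1) (b := σ - 1) (c := 1) zero_le_one hσ1 zero_le_one (by
        have : (σ + 1) / r = (σ - 1) / r + 1 / r + 1 / r := by ring
        linarith) (fun x => by
        have h4 := norm_rpow_smul_sub_le hσ (hv₁M x) (hv₂M x)
        have h5 : ‖g v₁ x - g v₂ x‖ₑ ≤ ENNReal.ofReal (σ + 1) * (‖M x‖ₑ ^ (σ - 1) * ‖d x‖ₑ) := by
          rw [← hMe _ hσ1, ← ofReal_norm (d x), ← mul_assoc, ← ENNReal.ofReal_mul hσ2,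
            ← ENNReal.ofReal_mul (mul_nonneg hσ2 (rpow_nonneg (hM0 x) _)), ← ofReal_norm]
          exact ENNReal.ofReal_le_ofReal h4
        rw [enorm_smul, ENNReal.rpow_one, ENNReal.rpow_one]
        refine (mul_le_mul_right h5 _).trans_eq ?_
        ring)
    simp only [ENNReal.rpow_one] at h
    refine h.trans ?_
    gcongr
  have hb₂ : eLpNorm (fun x => (u₁ - u₂ : SchwartzMap (EuclideanSpace ℝ (Fin N)) ℝ) x • g v₂ x)
      (ENNReal.ofReal r') ≤
      K * (ENNReal.ofReal (σ + 1) * (A ^ σ * eLpNorm d (ENNReal.ofReal r))) * A ^ σ := by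
    have h := eLpNorm_le_of_enorm_le_rpow_mul (μ := volume)
      (F := fun x => (u₁ - u₂ : SchwartzMap (EuclideanSpace ℝ (Fin N)) ℝ) x • g v₂ x)
      (hum (u₁ - u₂)) hMm hdm hr' hs' hr hr (K := 1)
      (a := 1) (b := σ) (c := 0) zero_le_one hσ0 le_rfl (by
        have : (σ + 1) / r = σ / r + 1 / r := by ring
        linarith [zero_div r]) (fun x => by
        have h5 : ‖g v₂ x‖ₑ ≤ ‖M x‖ₑ ^ σ := by
          rw [← hMe _ hσ0, ← ofReal_norm, norm_smul, Real.norm_of_nonneg (by positivity)]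
          refine ENNReal.ofReal_le_ofReal ?_
          have h6 := rpow_add_of_nonneg (norm_nonneg (v₂ x)) hσ1 zero_le_one
          rw [sub_add_cancel, rpow_one] at h6
          rw [← h6]
          exact rpow_le_rpow (norm_nonneg _) (hv₂M x) hσ0
        rw [enorm_smul, ENNReal.rpow_one, ENNReal.rpow_zero, mul_one, one_mul]
        exact mul_le_mul_right h5 _)
    simp only [ENNReal.rpow_one, ENNReal.rpow_zero, mul_one, one_mul] at h
    refine h.trans ?_
    gcongr
  rw [hsplit]
  refine (eLpNorm_add_le ((hum u₁).smul ((hgc v₁).sub (hgc v₂)).aestronglyMeasurable)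
    ((hum (u₁ - u₂)).smul (hgc v₂).aestronglyMeasurable)
    (by rw [← ENNReal.ofReal_one]; exact ENNReal.ofReal_le_ofReal hr1)).trans ?_
  refine (add_le_add hb₁ hb₂).trans_eq ?_
  have hA₁ : A ^ (2 * σ) = A ^ (σ + 1) * A ^ (σ - 1) := by
    rw [← ENNReal.rpow_add_of_nonneg _ _ hσ2 hσ1]
    ring_nf
  have hA₂ : A ^ (2 * σ) = A ^ σ * A ^ σ := by
    rw [← ENNReal.rpow_add_of_nonneg _ _ hσ0 hσ0, two_mul]
  have e₁ : ENNReal.ofReal (σ + 1) * (K * A ^ (σ + 1) * A ^ (σ - 1) *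
      eLpNorm d (ENNReal.ofReal r)) =
      K * ENNReal.ofReal (σ + 1) * (A ^ (2 * σ) * eLpNorm d (ENNReal.ofReal r)) := by
    rw [hA₁]; ring
  have e₂ : K * (ENNReal.ofReal (σ + 1) * (A ^ σ * eLpNorm d (ENNReal.ofReal r))) * A ^ σ =
      K * ENNReal.ofReal (σ + 1) * (A ^ (2 * σ) * eLpNorm d (ENNReal.ofReal r)) := by
    rw [hA₂]; ring
  rw [e₁, e₂, ← two_mul]
  simp only [mul_assoc, d]

lemma H1norm_nonneg (v : EuclideanSpace ℝ (Fin N) → ℂ) : 0 ≤ H1norm N v :=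
  Real.sqrt_nonneg _

lemma eLpNorm_two_le_ofReal_H1norm (v : SchwartzMap (EuclideanSpace ℝ (Fin N)) ℂ) :
    eLpNorm v 2 ≤ ENNReal.ofReal (H1norm N v) := by
  rw [← ENNReal.ofReal_toReal (v.memLp 2 volume).eLpNorm_ne_top]
  refine ENNReal.ofReal_le_ofReal (Real.le_sqrt_of_sq_le ?_)
  rw [LpN, ENNReal.ofReal_ofNat]
  exact le_add_of_nonneg_right (sq_nonneg _)

lemma eLpNorm_fderiv_two_le_ofReal_H1norm (v : SchwartzMap (EuclideanSpace ℝ (Fin N)) ℂ) :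
    eLpNorm (fderiv ℝ v) 2 ≤ ENNReal.ofReal (H1norm N v) := by
  rw [← ENNReal.ofReal_toReal (v.memLp_fderiv 2).eLpNorm_ne_top]
  exact ENNReal.ofReal_le_ofReal (Real.le_sqrt_of_sq_le (le_add_of_nonneg_left (sq_nonneg _)))

end Nonlinearity

/-- Local Lipschitz property of the Schrödinger–Helmholtz nonlinearity
`f(v) = u |v|^{σ-1} v`, where `u - α²Δu = |v|^{σ+1}`, from `H¹` into `L^{r'}`. -/
theorem stmt0 (N : ℕ) (hN : 1 ≤ N) (α : ℝ) (hα : 0 < α) (σ : ℝ) (hσ : 1 ≤ σ)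
    (hσ' : 2 < N → σ < 4 / ((N : ℝ) - 2)) :
    ∃ r r' : ℝ, 2 < r ∧ (2 < N → r ≤ 2 * N / ((N : ℝ) - 2)) ∧ 1 / r + 1 / r' = 1 ∧
      ∃ C : ℝ, 0 < C ∧
        ∀ (v₁ v₂ : SchwartzMap (EuclideanSpace ℝ (Fin N)) ℂ)
          (u₁ u₂ : SchwartzMap (EuclideanSpace ℝ (Fin N)) ℝ),
          (∀ x, u₁ x - α ^ 2 * lap N (fun y => u₁ y) x = ‖v₁ x‖ ^ (σ + 1)) →
          (∀ x, u₂ x - α ^ 2 * lap N (fun y => u₂ y) x = ‖v₂ x‖ ^ (σ + 1)) →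
          LpN N (fun x =>
              (u₁ x : ℂ) * ((‖v₁ x‖ ^ (σ - 1) : ℝ) : ℂ) * v₁ x
                - (u₂ x : ℂ) * ((‖v₂ x‖ ^ (σ - 1) : ℝ) : ℂ) * v₂ x) r'
            ≤ C * (H1norm N (fun y => v₁ y) + H1norm N (fun y => v₂ y)) ^ (2 * σ) *
                LpN N (fun x => v₁ x - v₂ x) r := by
  obtain ⟨s, s', hs, hs', hss, hr2, hrN, K, hKtop, hK⟩ := exists_exponents N hα hσ hσ'
  obtain ⟨r, hr⟩ : ∃ r, r = s * (σ + 1) := ⟨_, rfl⟩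
  rw [← hr] at hr2 hrN
  have hr0 : 0 < r := by linarith
  have hr1 : 0 < r - 1 := by linarith
  have hrr : 1 / r + 1 / (r / (r - 1)) = 1 := by field_simp; ring
  obtain ⟨S, hS⟩ := exists_eLpNorm_le_of_eLpNorm_fderiv_le N hN hr2.le hrN
  have hBtop : 2 * K * ENNReal.ofReal (σ + 1) * (S : ℝ≥0∞) ^ (2 * σ) ≠ ∞ :=
    ENNReal.mul_ne_top (by finiteness) (ENNReal.rpow_ne_top_of_nonneg (by linarith) (by simp))
  obtain ⟨B, hB⟩ : ∃ B : ℝ≥0, (B : ℝ≥0∞) = _ := ⟨_, ENNReal.coe_toNNReal hBtop⟩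
  refine ⟨r, r / (r - 1), hr2, hrN, hrr, B + 1, by positivity, fun v₁ v₂ u₁ u₂ h₁ h₂ => ?_⟩
  have hH₁ := H1norm_nonneg v₁
  have hH₂ := H1norm_nonneg v₂
  have hSob : ∀ v : SchwartzMap (EuclideanSpace ℝ (Fin N)) ℂ,
      eLpNorm v (ENNReal.ofReal r) ≤ S * ENNReal.ofReal (H1norm N v) := fun v =>
    hS v _ (eLpNorm_two_le_ofReal_H1norm v) (eLpNorm_fderiv_two_le_ofReal_H1norm v)
  have hA : eLpNorm (fun x => ‖v₁ x‖ + ‖v₂ x‖) (ENNReal.ofReal r) ≤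
      S * ENNReal.ofReal (H1norm N v₁ + H1norm N v₂) := by
    refine (eLpNorm_add_le v₁.continuous.norm.aestronglyMeasurable
      v₂.continuous.norm.aestronglyMeasurable ?_).trans ?_
    · rw [← ENNReal.ofReal_one]
      exact ENNReal.ofReal_le_ofReal (by linarith)
    · rw [eLpNorm_norm, eLpNorm_norm, ENNReal.ofReal_add hH₁ hH₂, mul_add]
      exact add_le_add (hSob v₁) (hSob v₂)
  have key := eLpNorm_nonlinearity_sub_le hσ hs hs' hr0 (div_pos hr0 hr1) hss hrr hr hK h₁ h₂ hA
  have hd : eLpNorm (fun x => v₁ x - v₂ x) (ENNReal.ofReal r) =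
      ENNReal.ofReal (LpN N (fun x => v₁ x - v₂ x) r) :=
    (ENNReal.ofReal_toReal ((v₁ - v₂).memLp _ volume).eLpNorm_ne_top).symm
  have hd0 : 0 ≤ LpN N (fun x => v₁ x - v₂ x) r := ENNReal.toReal_nonneg
  have hH : 0 ≤ (H1norm N v₁ + H1norm N v₂) ^ (2 * σ) := by positivity
  rw [ENNReal.mul_rpow_of_nonneg _ _ (by linarith), mul_assoc (_ ^ _), ← mul_assoc _ (_ ^ _),
    ← hB, ENNReal.ofReal_rpow_of_nonneg (by positivity) (by linarith), hd,
    ← ENNReal.ofReal_mul hH, ← ENNReal.ofReal_coe_nnreal, ← ENNReal.ofReal_mul B.coe_nonneg] at key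
  refine (ENNReal.toReal_le_of_le_ofReal (by positivity) key).trans ?_
  rw [mul_assoc]
  exact mul_le_mul_of_nonneg_right (le_add_of_nonneg_right zero_le_one) (mul_nonneg hH hd0)
end
end

section
/- Let N ≥ 1, α > 0, and let 1 ≤ σ < 4/(N−2) (interpreted as σ ≥ 1 arbitrary when N ≤ 2). Then there exists an exponent r with 2 < r ≤ 2N/(N−2) (interpreted as 2 < r < ∞ when N ≤ 2) and a constant C_α > 0, depending only on N, σ, α, such that: for every Schwartz function v : ℝ^N → ℂ and every Schwartz function w : ℝ^N → ℂ satisfying w − α²Δw = |v|^{σ−1} v pointwise on ℝ^N, and for all Schwartz functions v₁, v₂ : ℝ^N → ℂ, one has ‖w · |v|^{σ−1} v · (v₁ − v₂)‖_{L^{r'}} ≤ C_α ‖v‖_{H¹}^{2σ} ‖v₁ − v₂‖_{L^r}, where 1/r + 1/r' = 1. -/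
open MeasureTheory Real Set
open scoped ENNReal NNReal ComplexConjugate

noncomputable section

section Helmholtz

open SchwartzMap Laplacian FourierTransform
open scoped RealInnerProductSpace

variable {V : Type*} [NormedAddCommGroup V] [InnerProductSpace ℝ V] [FiniteDimensional ℝ V]
  [MeasurableSpace V] [BorelSpace V]

theorem integral_gaussian_mul_fourier {b : ℝ} (hb : 0 < b) (f : 𝓢(V, ℂ)) (x : V) :
    ∫ ξ, Complex.exp (-b * ‖ξ‖ ^ 2 + 2 * π * Complex.I * ⟪x, ξ⟫) * 𝓕 f ξ =
      ∫ y, (((π / b) ^ (Module.finrank ℝ V / 2 : ℝ) *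
        rexp (-(π ^ 2 / b) * ‖x - y‖ ^ 2) : ℝ) : ℂ) * f y := by
  have hb' : 0 < ((b : ℂ)).re := by simpa
  have hint := GaussianFourier.integrable_cexp_neg_mul_sq_norm_add hb' (2 * π * Complex.I) x
  have h := VectorFourier.integral_fourierIntegral_smul_eq_flip (L := innerₗ V)
    (μ := volume) (ν := volume) continuous_fourierChar continuous_inner f.integrable hint
  have h1 : ∀ ξ, VectorFourier.fourierIntegral 𝐞 volume (innerₗ V) (f : V → ℂ) ξ = 𝓕 f ξ :=
    fun ξ => rfl
  have h2 : ∀ y, VectorFourier.fourierIntegral 𝐞 volume (innerₗ V).flip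
      (fun v ↦ Complex.exp (-b * ‖v‖ ^ 2 + 2 * π * Complex.I * ⟪x, v⟫)) y =
      (((π / b) ^ (Module.finrank ℝ V / 2 : ℝ) *
        rexp (-(π ^ 2 / b) * ‖x - y‖ ^ 2) : ℝ) : ℂ) := by
    intro y
    rw [flip_innerₗ]
    refine (fourier_gaussian_innerProductSpace' hb' x y).trans ?_
    rw [Complex.ofReal_mul, Complex.ofReal_cpow (by positivity), Complex.ofReal_exp]
    push_cast
    congr 2
    ring
  simp_rw [h1, h2, smul_eq_mul] at h
  simpa [mul_comm] using h

theorem fourier_helmholtz {c : ℝ} {f w : 𝓢(V, ℂ)} (h : w - c • Δ w = f) (ξ : V) :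
    𝓕 f ξ = (1 + c * (2 * π) ^ 2 * ‖ξ‖ ^ 2 : ℝ) * 𝓕 w ξ := by
  have hg : (fun ξ : V => ‖ξ‖ ^ 2).HasTemperateGrowth := by fun_prop
  rw [← h, laplacian_eq_fourierMultiplierCLM, fourierMultiplierCLM_apply,
    ← FourierTransform.fourierInv_smul, ← FourierTransform.fourierInv_smul, sub_eq_add_neg,
    FourierTransform.fourier_add, FourierTransform.fourier_neg, FourierTransform.fourier_fourierInv_eq]
  simp only [_root_.add_apply, _root_.neg_apply, _root_.smul_apply]
  rw [show ((‖·‖ ^ 2 : V → ℝ)) = (fun ξ : V => ‖ξ‖ ^ 2) from rfl,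
    SchwartzMap.smulLeftCLM_apply_apply hg]
  simp only [Complex.real_smul]
  push_cast
  ring

theorem lintegral_gaussian {c : ℝ} (hc : 0 < c) (x : V) :
    ∫⁻ y : V, ENNReal.ofReal (rexp (-c * ‖x - y‖ ^ 2)) =
      ENNReal.ofReal ((π / c) ^ (Module.finrank ℝ V / 2 : ℝ)) := by
  have hint : Integrable (fun y : V => rexp (-c * ‖y‖ ^ 2)) := by
    have := (GaussianFourier.integrable_cexp_neg_mul_sq_norm_add (b := c) (by simpa) 0 (0 : V)).norm
    refine this.congr (.of_forall fun y => ?_)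
    simp [Complex.norm_exp, ← Complex.ofReal_pow]
  rw [← GaussianFourier.integral_rexp_neg_mul_sq_norm hc,
    ofReal_integral_eq_lintegral_ofReal hint (.of_forall fun y => (Real.exp_pos _).le)]
  exact lintegral_sub_left_eq_self (fun y : V => ENNReal.ofReal (rexp (-c * ‖y‖ ^ 2))) x

theorem norm_integral_gaussian_mul_le {A c p q : ℝ} (hA : 0 ≤ A) (hc : 0 < c)
    (hpq : p.HolderConjugate q) (f : 𝓢(V, ℂ)) (x : V) :
    ‖∫ y, ((A * rexp (-c * ‖x - y‖ ^ 2) : ℝ) : ℂ) * f y‖ ≤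
      A * (π / (p * c)) ^ (Module.finrank ℝ V / (2 * p) : ℝ) *
        (eLpNorm f (ENNReal.ofReal q) volume).toReal := by
  have hp := hpq.pos
  have hq := hpq.symm.pos
  have hf : eLpNorm f (ENNReal.ofReal q) volume ≠ ∞ := (f.memLp _ _).eLpNorm_ne_top
  rw [← ENNReal.toReal_ofReal (by positivity : 0 ≤ A * (π / (p * c)) ^ (Module.finrank ℝ V / (2 * p) : ℝ)), ← ENNReal.toReal_mul,
    ← toReal_enorm]
  refine ENNReal.toReal_mono (ENNReal.mul_ne_top ENNReal.ofReal_ne_top hf) ?_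
  refine (enorm_integral_le_lintegral_enorm _).trans ?_
  have h1 : ∀ y, ‖((A * rexp (-c * ‖x - y‖ ^ 2) : ℝ) : ℂ) * f y‖ₑ =
      ENNReal.ofReal A * (ENNReal.ofReal (rexp (-c * ‖x - y‖ ^ 2)) * ‖f y‖ₑ) := by
    intro y
    rw [enorm_mul, ← mul_assoc, ← ENNReal.ofReal_mul hA, ← ofReal_norm, Complex.norm_real,
      Real.norm_of_nonneg (by positivity)]
  simp_rw [h1]
  rw [lintegral_const_mul' _ _ ENNReal.ofReal_ne_top, ENNReal.ofReal_mul hA, mul_assoc]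
  gcongr
  refine (ENNReal.lintegral_mul_le_Lp_mul_Lq volume hpq (by fun_prop)
    f.continuous.enorm.measurable.aemeasurable).trans (le_of_eq ?_)
  have h2 : ∀ y : V, ENNReal.ofReal (rexp (-c * ‖x - y‖ ^ 2)) ^ p =
      ENNReal.ofReal (rexp (-(p * c) * ‖x - y‖ ^ 2)) := by
    intro y
    rw [ENNReal.ofReal_rpow_of_nonneg (Real.exp_pos _).le hp.le, ← Real.exp_mul]
    ring_nf
  simp_rw [h2]
  rw [lintegral_gaussian (by positivity), ENNReal.ofReal_rpow_of_nonneg (by positivity)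
    (by positivity), ← Real.rpow_mul (by positivity), eLpNorm_eq_lintegral_rpow_enorm_toReal
    (by simpa using hq) ENNReal.ofReal_ne_top, ENNReal.toReal_ofReal hq.le]
  congr 3
  field_simp

/-- Pointwise bound on solutions of the Helmholtz equation, from writing the resolvent as the
Laplace transform of the heat semigroup. -/
theorem exists_norm_le_of_helmholtz {c q : ℝ} (hc : 0 < c) (hq : 1 < q)
    (hd : (Module.finrank ℝ V : ℝ) / 2 / q < 1) :
    ∃ C : ℝ, 0 ≤ C ∧ ∀ f w : 𝓢(V, ℂ), w - c • Δ w = f →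
      ∀ x, ‖w x‖ ≤ C * (eLpNorm f (ENNReal.ofReal q) volume).toReal := by
  set d : ℝ := (Module.finrank ℝ V : ℝ) / 2 with hd_def
  set K : ℝ := c * (2 * π) ^ 2 with hK_def
  have hK : 0 < K := by positivity
  obtain ⟨p, hqp⟩ : ∃ p, q.HolderConjugate p := ⟨_, Real.HolderConjugate.conjExponent hq⟩
  have hp := hqp.symm.pos
  have hq0 := hqp.pos
  have hΓ := Real.GammaIntegral_convergent (sub_pos.2 hd)
  refine ⟨(π / K) ^ (d / q) * p ^ (-(d / p)) *
    ∫ s in Ioi (0 : ℝ), rexp (-s) * s ^ (1 - d / q - 1), ?_, fun f w h x => ?_⟩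
  · exact mul_nonneg (by positivity) (setIntegral_nonneg measurableSet_Ioi fun s hs =>
      mul_nonneg (Real.exp_pos _).le (Real.rpow_nonneg (le_of_lt hs) _))
  set F : V → ℝ → ℂ := fun ξ s => Complex.exp (-(s * K : ℝ) * ‖ξ‖ ^ 2 + 2 * π * Complex.I * ⟪x, ξ⟫)
    * 𝓕 f ξ * (rexp (-s) : ℝ) with hF
  have hF_norm : ∀ ξ s, ‖F ξ s‖ = rexp (-(s * K) * ‖ξ‖ ^ 2) * ‖𝓕 f ξ‖ * rexp (-s) := by
    intro ξ s
    simp only [hF, norm_mul, Complex.norm_exp, Complex.norm_real, Real.norm_eq_abs, Real.abs_exp]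
    congr 3
    simp [← Complex.ofReal_pow]
  have hF_int : Integrable (Function.uncurry F) (volume.prod (volume.restrict (Ioi 0))) := by
    have h0 : Integrable (fun s : ℝ => rexp (-s)) (volume.restrict (Ioi 0)) := by
      simpa [IntegrableOn] using exp_neg_integrableOn_Ioi 0 one_pos
    have h1 : Integrable (fun z : V × ℝ => ‖𝓕 f z.1‖ * rexp (-z.2))
        (volume.prod (volume.restrict (Ioi 0))) := (𝓕 f).integrable.norm.mul_prod h0
    refine h1.mono' ?_ ?_
    · refine Continuous.aestronglyMeasurable ?_
      have := (𝓕 f).continuous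
      simp only [hF, Function.uncurry_def]
      fun_prop
    · have : ∀ᵐ z : V × ℝ ∂(volume.prod (volume.restrict (Ioi 0))), z.2 ∈ Ioi (0 : ℝ) :=
        Measure.quasiMeasurePreserving_snd.ae (ae_restrict_mem measurableSet_Ioi)
      filter_upwards [this] with z hz
      rw [Function.uncurry_def, hF_norm, mul_assoc]
      refine mul_le_of_le_one_left (by positivity) (Real.exp_le_one_iff.2 ?_)
      have : 0 ≤ z.2 * K * ‖z.1‖ ^ 2 := by have := mem_Ioi.1 hz; positivity
      linarith
  have hw : w x = ∫ ξ, ∫ s in Ioi (0 : ℝ), F ξ s := by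
    have h0 : w x = 𝓕⁻ (𝓕 w) x := by rw [FourierTransform.fourierInv_fourier_eq]
    rw [h0, fourierInv_coe, fourierInv_eq']
    refine integral_congr_ae (.of_forall fun ξ => ?_)
    have hm : 0 < 1 + K * ‖ξ‖ ^ 2 := by positivity
    have h2 : ∀ s : ℝ, F ξ s = Complex.exp (((2 * π * ⟪ξ, x⟫ : ℝ) : ℂ) * Complex.I) * 𝓕 f ξ *
        (rexp (-(1 + K * ‖ξ‖ ^ 2) * s) : ℝ) := by
      intro s
      simp only [hF, Complex.ofReal_exp]
      rw [mul_right_comm, mul_right_comm _ (𝓕 f ξ), ← Complex.exp_add, ← Complex.exp_add,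
        real_inner_comm]
      congr 2
      push_cast
      ring
    simp only [smul_eq_mul]
    simp_rw [h2]
    rw [integral_const_mul, integral_complex_ofReal, integral_exp_mul_Ioi (by linarith),
      fourier_helmholtz h]
    have : ((1 + K * ‖ξ‖ ^ 2 : ℝ) : ℂ) ≠ 0 := by exact_mod_cast hm.ne'
    simp only [← hK_def, mul_zero, Real.exp_zero, neg_div_neg_eq]
    rw [Complex.ofReal_div, Complex.ofReal_one]
    field_simp
  rw [hw, integral_integral_swap hF_int]
  have hbound : ∀ s ∈ Ioi (0 : ℝ), ‖∫ ξ, F ξ s‖ ≤ (π / K) ^ (d / q) * p ^ (-(d / p)) *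
      (eLpNorm f (ENNReal.ofReal q) volume).toReal * (rexp (-s) * s ^ (1 - d / q - 1)) := by
    intro s hs
    have hs : 0 < s := hs
    simp only [hF]
    rw [integral_mul_const, integral_gaussian_mul_fourier (by positivity), norm_mul,
      Complex.norm_real, Real.norm_of_nonneg (Real.exp_pos _).le]
    have := norm_integral_gaussian_mul_le (A := (π / (s * K)) ^ d) (c := π ^ 2 / (s * K))
      (by positivity) (by positivity) hqp.symm f x
    refine (mul_le_mul_of_nonneg_right this (Real.exp_pos _).le).trans (le_of_eq ?_)
    have e1 : (π / (p * (π ^ 2 / (s * K)))) = (π / (s * K))⁻¹ * p⁻¹ := by field_simp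
    have e2 : (Module.finrank ℝ V : ℝ) / (2 * p) = d / p := by rw [hd_def]; field_simp
    have e3 : d + -(d / p) = d / q := by
      have := hqp.inv_add_inv_eq_one
      have : d * (q⁻¹ + p⁻¹) = d := by rw [this, mul_one]
      rw [div_eq_mul_inv, div_eq_mul_inv]; linarith
    have e4 : π / (s * K) = π / K * s⁻¹ := by field_simp
    rw [e2, e1, Real.mul_rpow (by positivity) (by positivity), Real.inv_rpow (by positivity),
      Real.inv_rpow hp.le, ← Real.rpow_neg (by positivity), ← Real.rpow_neg hp.le, ← mul_assoc,
      ← Real.rpow_add (by positivity), e3, e4, Real.mul_rpow (by positivity) (by positivity),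
      Real.inv_rpow hs.le, ← Real.rpow_neg hs.le, show 1 - d / q - 1 = -(d / q) by ring]
    ring
  refine (norm_integral_le_of_norm_le (hΓ.const_mul _)
    ((ae_restrict_iff' measurableSet_Ioi).2 (.of_forall hbound))).trans (le_of_eq ?_)
  rw [integral_const_mul]
  ring

end Helmholtz

section Sobolev

open SchwartzMap Module Filter Topology

/-- The Gagliardo–Nirenberg–Sobolev inequality without the assumption of compact support. -/
theorem eLpNorm_le_eLpNorm_fderiv_of_memLp {V F : Type*} [NormedAddCommGroup V]
    [InnerProductSpace ℝ V] [FiniteDimensional ℝ V] [MeasurableSpace V] [BorelSpace V]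
    [NormedAddCommGroup F] [NormedSpace ℝ F] [FiniteDimensional ℝ F]
    {u : V → F} (hu : ContDiff ℝ 1 u) {p p' : ℝ≥0} (hp : 1 ≤ p) (hn : 0 < finrank ℝ V)
    (hp' : (p' : ℝ)⁻¹ = p⁻¹ - (finrank ℝ V : ℝ)⁻¹) (hmem : MemLp u p volume) :
    eLpNorm u p' volume ≤
      SNormLESNormFDerivOfEqConst F (volume : Measure V) p * eLpNorm (fderiv ℝ u) p volume := by
  set C := SNormLESNormFDerivOfEqConst F (volume : Measure V) p
  let χ : ContDiffBump (0 : V) := ⟨1, 2, one_pos, one_lt_two⟩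
  have hχ : ContDiff ℝ 1 χ := χ.contDiff
  obtain ⟨M, hM⟩ := (χ.hasCompactSupport.fderiv (𝕜 := ℝ)).exists_bound_of_continuous
    (hχ.continuous_fderiv one_ne_zero)
  have hM0 : 0 ≤ M := (norm_nonneg _).trans (hM 0)
  let ε : ℕ → ℝ := fun n => ((n : ℝ) + 1)⁻¹
  have hε0 : ∀ n, 0 < ε n := fun n => by positivity
  have hε : Tendsto ε atTop (𝓝 0) := by
    simpa [ε, one_div] using tendsto_one_div_add_atTop_nhds_zero_nat (𝕜 := ℝ)
  let ρ : ℕ → V → ℝ := fun n x => χ (ε n • x)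
  have hρ : ∀ n, ContDiff ℝ 1 (ρ n) := fun n => hχ.comp (by fun_prop)
  have hρ' : ∀ n x, ‖fderiv ℝ (ρ n) x‖ ≤ ε n * M := by
    intro n x
    simp only [ρ]
    rw [fderiv_comp_smul, norm_smul, Real.norm_of_nonneg (hε0 n).le]
    exact mul_le_mul_of_nonneg_left (hM _) (hε0 n).le
  have hρ1 : ∀ n x, ‖ρ n x‖ ≤ 1 := fun n x => by
    rw [Real.norm_of_nonneg χ.nonneg]; exact χ.le_one
  have hbound : ∀ n, eLpNorm (fun x => ρ n x • u x) p' volume ≤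
      C * (eLpNorm (fderiv ℝ u) p volume + ENNReal.ofReal (ε n * M) * eLpNorm u p volume) := by
    intro n
    have hsupp : HasCompactSupport (ρ n) :=
      χ.hasCompactSupport.comp_homeomorph (Homeomorph.smulOfNeZero (ε n) (hε0 n).ne')
    refine (eLpNorm_le_eLpNorm_fderiv_of_eq volume ((hρ n).smul hu) hsupp.smul_right hp hn
      hp').trans ?_
    gcongr
    have hd : fderiv ℝ (ρ n • u) =
        (fun x => ρ n x • fderiv ℝ u x) + fun x => (fderiv ℝ (ρ n) x).smulRight (u x) := by
      ext1 x
      rw [fderiv_smul ((hρ n).differentiable one_ne_zero x) (hu.differentiable one_ne_zero x)]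
      rfl
    have hfu := hu.continuous_fderiv one_ne_zero
    have hfρ := (hρ n).continuous_fderiv one_ne_zero
    have hρc := (hρ n).continuous
    have huc := hu.continuous
    have hc : Continuous fun x => (fderiv ℝ (ρ n) x).smulRight (u x) :=
      (ContinuousLinearMap.smulRightL ℝ V F).continuous₂.comp (hfρ.prodMk huc)
    rw [hd]
    refine (eLpNorm_add_le (by fun_prop) hc.aestronglyMeasurable
      (by exact_mod_cast hp)).trans (add_le_add ?_ ?_)
    · refine eLpNorm_mono fun x => ?_
      rw [norm_smul]
      exact mul_le_of_le_one_left (norm_nonneg _) (hρ1 n x)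
    · refine eLpNorm_le_mul_eLpNorm_of_ae_le_mul (.of_forall fun x => ?_) _
      rw [ContinuousLinearMap.norm_smulRight_apply]
      exact mul_le_mul_of_nonneg_right (hρ' n x) (norm_nonneg _)
  have hlim : Tendsto (fun n => (C : ℝ≥0∞) * (eLpNorm (fderiv ℝ u) p volume +
      ENNReal.ofReal (ε n * M) * eLpNorm u p volume)) atTop
      (𝓝 (C * (eLpNorm (fderiv ℝ u) p volume + 0 * eLpNorm u p volume))) := by
    refine ENNReal.Tendsto.const_mul (tendsto_const_nhds.add
      (ENNReal.Tendsto.mul_const ?_ (.inr hmem.eLpNorm_ne_top))) (.inr ENNReal.coe_ne_top)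
    rw [← ENNReal.ofReal_zero, ← zero_mul M]
    exact ENNReal.tendsto_ofReal (hε.mul_const M)
  rw [zero_mul, add_zero] at hlim
  refine (Lp.eLpNorm_lim_le_liminf_eLpNorm
    (fun n => ((hρ n).continuous.smul hu.continuous).aestronglyMeasurable) u
    (.of_forall fun x => ?_)).trans ((liminf_le_liminf (.of_forall hbound)).trans_eq
      hlim.liminf_eq)
  have h1 : Tendsto (fun n => ρ n x) atTop (𝓝 1) := by
    have h0 : χ 0 = 1 := χ.one_of_mem_closedBall (by simp [χ])
    have := (χ.continuous.tendsto 0).comp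
      (show Tendsto (fun n => ε n • x) atTop (𝓝 0) by simpa using hε.smul_const x)
    rwa [h0] at this
  simpa using h1.smul_const (u x)

theorem eLpNorm_pow_eq {X : Type*} [MeasurableSpace X] {μ : Measure X} (f : X → ℂ) (p : ℝ≥0∞)
    {k : ℕ} (hk : k ≠ 0) : eLpNorm (fun x => f x ^ k) p μ = eLpNorm f (p * k) μ ^ k := by
  have h := eLpNorm_norm_rpow (μ := μ) (p := p) f (q := k) (by positivity)
  rw [ENNReal.ofReal_natCast, ENNReal.rpow_natCast] at h
  rw [← h]
  exact eLpNorm_congr_norm_ae (.of_forall fun x => by simp)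

theorem ennreal_le_mul_of_pow_le {a h : ℝ≥0∞} {A : ℝ≥0} {k : ℕ} (hk : k ≠ 0)
    (H : a ^ k ≤ A * h ^ k) : a ≤ (1 + A : ℝ≥0) * h := by
  rw [← ENNReal.pow_le_pow_left_iff hk, mul_pow]
  refine H.trans ?_
  gcongr
  rw [← ENNReal.coe_pow, ENNReal.coe_le_coe]
  exact le_add_self.trans (le_self_pow₀ le_self_add hk)

section

variable {N : ℕ} (v : 𝓢(EuclideanSpace ℝ (Fin N), ℂ))

theorem eLpNorm_two_le_H1norm :
    eLpNorm v 2 volume ≤ ENNReal.ofReal (H1norm N v) := by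
  rw [← ENNReal.ofReal_toReal (v.memLp 2 volume).eLpNorm_ne_top]
  refine ENNReal.ofReal_le_ofReal (Real.le_sqrt_of_sq_le ?_)
  rw [LpN, ENNReal.ofReal_ofNat]
  exact le_add_of_nonneg_right (sq_nonneg _)

theorem eLpNorm_fderiv_two_le_H1norm :
    eLpNorm (fderiv ℝ v) 2 volume ≤ ENNReal.ofReal (H1norm N v) := by
  have h : MemLp (fderiv ℝ v) 2 volume := (fderivCLM ℝ _ _ v).memLp 2 volume
  rw [← ENNReal.ofReal_toReal h.eLpNorm_ne_top]
  refine ENNReal.ofReal_le_ofReal (Real.le_sqrt_of_sq_le ?_)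
  exact le_add_of_nonneg_left (sq_nonneg _)

end

theorem exists_eLpNorm_le_H1norm_of_two_lt {N : ℕ} (hN : 2 < N) :
    ∃ C : ℝ≥0, ∀ v : 𝓢(EuclideanSpace ℝ (Fin N), ℂ),
      eLpNorm v (ENNReal.ofReal (2 * N / ((N : ℝ) - 2))) volume ≤
        C * ENNReal.ofReal (H1norm N v) := by
  have hN' : (2 : ℝ) < N := by exact_mod_cast hN
  refine ⟨SNormLESNormFDerivOfEqConst ℂ (volume : Measure (EuclideanSpace ℝ (Fin N))) (2 : ℝ≥0),
    fun v => ?_⟩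
  have := eLpNorm_le_eLpNorm_fderiv_of_memLp (v.smooth 1) (p := 2)
    (p' := (2 * N / ((N : ℝ) - 2)).toNNReal) one_le_two (by simp; omega) ?_ (v.memLp _)
  · refine this.trans ?_
    gcongr
    exact eLpNorm_fderiv_two_le_H1norm v
  · have : 0 < (N : ℝ) - 2 := by linarith
    rw [Real.coe_toNNReal _ (by positivity), finrank_euclideanSpace_fin]
    simp only [NNReal.coe_inv, NNReal.coe_ofNat]
    field_simp

theorem exists_eLpNorm_le_H1norm_of_eq_two {m : ℕ} (hm : 1 ≤ m) :
    ∃ C : ℝ≥0, ∀ v : 𝓢(EuclideanSpace ℝ (Fin 2), ℂ),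
      eLpNorm v (2 * m) volume ≤ C * ENNReal.ofReal (H1norm 2 v) := by
  induction m, hm using Nat.le_induction with
  | base => exact ⟨1, fun v => by simpa using eLpNorm_two_le_H1norm v⟩
  | succ m hm ih =>
    obtain ⟨C, hC⟩ := ih
    set S := SNormLESNormFDerivOfEqConst ℂ (volume : Measure (EuclideanSpace ℝ (Fin 2))) (1 : ℝ≥0)
    refine ⟨1 + S * ((m + 1) * C ^ m), fun v => ennreal_le_mul_of_pow_le m.succ_ne_zero ?_⟩
    have hu : ContDiff ℝ 1 (fun x => v x ^ (m + 1)) := (v.smooth 1).pow _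
    have hmem : MemLp (fun x => v x ^ (m + 1)) (1 : ℝ≥0) volume := by
      refine ⟨hu.continuous.aestronglyMeasurable, ?_⟩
      rw [eLpNorm_pow_eq _ _ m.succ_ne_zero]
      have h := v.memLp ((1 : ℝ≥0) * (m + 1 : ℕ)) volume
      exact ENNReal.pow_lt_top h.eLpNorm_lt_top
    have h := eLpNorm_le_eLpNorm_fderiv_of_memLp hu (p := 1) (p' := 2) le_rfl (by simp)
      (by norm_num) hmem
    rw [eLpNorm_pow_eq _ _ m.succ_ne_zero] at h
    have hd : fderiv ℝ (fun x => v x ^ (m + 1)) =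
        ((m : ℂ) + 1) • fun x => v x ^ m • fderiv ℝ v x := by
      ext1 x
      rw [fderiv_fun_pow _ (v.differentiable x)]
      simp [smul_smul]
    have hprod : eLpNorm (fun x => v x ^ m • fderiv ℝ v x) 1 volume ≤
        (C * ENNReal.ofReal (H1norm 2 v)) ^ m * ENNReal.ofReal (H1norm 2 v) := by
      refine (eLpNorm_smul_le_mul_eLpNorm (p := 2) (q := 2)
        (fderivCLM ℝ _ _ v).continuous.aestronglyMeasurable
        (v.continuous.pow m).aestronglyMeasurable).trans ?_
      rw [show ⇑v ^ m = fun x => v x ^ m from rfl, eLpNorm_pow_eq _ _ (Nat.ne_of_gt hm)]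
      gcongr
      · exact hC v
      · exact eLpNorm_fderiv_two_le_H1norm v
    refine h.trans ?_
    rw [hd, ENNReal.coe_one, eLpNorm_const_smul ((m : ℂ) + 1) (fun x => v x ^ m • fderiv ℝ v x)]
    have he : ‖(m : ℂ) + 1‖ₑ = (m : ℝ≥0∞) + 1 := by
      have : (m : ℂ) + 1 = ((m + 1 : ℕ) : ℂ) := by push_cast; rfl
      rw [this, ← ofReal_norm, Complex.norm_natCast, ENNReal.ofReal_natCast]
      push_cast; rfl
    rw [he]
    refine (mul_le_mul_right (mul_le_mul_right hprod _) _).trans_eq ?_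
    simp only [S, Nat.succ_eq_add_one]
    push_cast
    ring

theorem SchwartzMap.enorm_sq_le_mul_deriv (g : 𝓢(ℝ, ℂ)) (t : ℝ) :
    ‖g t‖ₑ ^ 2 ≤ 2 * (eLpNorm g 2 volume * eLpNorm (deriv g) 2 volume) := by
  have hg' : MemLp (deriv g) 2 volume := (derivCLM ℝ _ g).memLp 2 volume
  have hint : Integrable (fun s => 2 * (g s * deriv g s)) :=
    ((g.memLp 2).integrable_mul hg').const_mul 2
  have hderiv : ∀ s ∈ Iic t, HasDerivAt (fun s => g s ^ 2) (2 * (g s * deriv g s)) s :=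
    fun s _ => by
      simpa [mul_assoc] using (g.differentiable s).hasDerivAt.fun_pow 2
  have hlim : Tendsto (fun s => g s ^ 2) atBot (𝓝 0) := by
    have := (g.toZeroAtInfty.zero_at_infty').mono_left atBot_le_cocompact
    simpa using this.pow 2
  have := integral_Iic_of_hasDerivAt_of_tendsto' hderiv hint.integrableOn hlim
  rw [sub_zero] at this
  rw [← enorm_pow, ← this]
  refine (enorm_integral_le_lintegral_enorm _).trans ((setLIntegral_le_lintegral _ _).trans ?_)
  rw [← eLpNorm_one_eq_lintegral_enorm]
  have h2 := eLpNorm_smul_le_mul_eLpNorm (p := 2) (q := 2) (r := 1) (μ := volume)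
    hg'.1 g.continuous.aestronglyMeasurable
  calc eLpNorm (fun s => 2 * (g s * deriv g s)) 1 volume
      = ‖(2 : ℂ)‖ₑ * eLpNorm (fun s => g s * deriv g s) 1 volume :=
        eLpNorm_const_smul (2 : ℂ) (fun s => g s * deriv g s) 1 volume
    _ ≤ 2 * (eLpNorm g 2 volume * eLpNorm (deriv g) 2 volume) := by
        rw [← ofReal_norm]
        simp only [Complex.norm_ofNat, ENNReal.ofReal_ofNat]
        gcongr
        exact h2

theorem enorm_le_H1norm_of_eq_one (v : 𝓢(EuclideanSpace ℝ (Fin 1), ℂ))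
    (x : EuclideanSpace ℝ (Fin 1)) : ‖v x‖ₑ ≤ 3 * ENNReal.ofReal (H1norm 1 v) := by
  let e : ℝ ≃ₗᵢ[ℝ] EuclideanSpace ℝ (Fin 1) := (OrthonormalBasis.singleton (Fin 1) ℝ).repr
  let g : 𝓢(ℝ, ℂ) := compCLMOfContinuousLinearEquiv ℝ e.toContinuousLinearEquiv v
  have hg : ⇑g = v ∘ e := rfl
  have h := g.enorm_sq_le_mul_deriv (e.symm x)
  have hv : AEStronglyMeasurable (fderiv ℝ v) volume :=
    (fderivCLM ℝ _ _ v).continuous.aestronglyMeasurable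
  have h1 : eLpNorm g 2 volume = eLpNorm v 2 volume := by
    rw [hg, eLpNorm_comp_measurePreserving v.continuous.aestronglyMeasurable e.measurePreserving]
  have h2 : eLpNorm (deriv g) 2 volume ≤ eLpNorm (fderiv ℝ v) 2 volume := by
    rw [← eLpNorm_comp_measurePreserving hv e.measurePreserving]
    refine eLpNorm_mono fun t => ?_
    have : HasDerivAt g (fderiv ℝ v (e t) (e 1)) t :=
      (v.differentiable (e t)).hasFDerivAt.comp_hasDerivAt t
        (e.toContinuousLinearEquiv.toContinuousLinearMap.hasDerivAt (x := t))
    rw [this.deriv]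
    simpa using (fderiv ℝ v (e t)).le_opNorm (e 1)
  rw [h1, show g (e.symm x) = v x by simp [hg]] at h
  have h3 := ennreal_le_mul_of_pow_le (a := ‖v x‖ₑ) (h := ENNReal.ofReal (H1norm 1 v)) (A := 2)
    two_ne_zero (h.trans ?_)
  · refine h3.trans_eq ?_
    norm_num
  · rw [sq]
    push_cast
    gcongr
    · exact eLpNorm_two_le_H1norm v
    · exact h2.trans (eLpNorm_fderiv_two_le_H1norm v)

theorem exists_eLpNorm_le_H1norm_of_eq_one {m : ℕ} (hm : 1 ≤ m) :
    ∃ C : ℝ≥0, ∀ v : 𝓢(EuclideanSpace ℝ (Fin 1), ℂ),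
      eLpNorm v (2 * m) volume ≤ C * ENNReal.ofReal (H1norm 1 v) := by
  obtain ⟨k, rfl⟩ := Nat.exists_eq_add_of_le' hm
  refine ⟨1 + 3 ^ k, fun v => ennreal_le_mul_of_pow_le k.succ_ne_zero ?_⟩
  set h := H1norm 1 v
  have hh : 0 ≤ h := Real.sqrt_nonneg _
  rw [← eLpNorm_pow_eq _ _ k.succ_ne_zero]
  have : ∀ x, ‖v x ^ (k + 1)‖ ≤ (3 * h) ^ k * ‖v x‖ := by
    intro x
    rw [norm_pow, pow_succ]
    gcongr
    have := enorm_le_H1norm_of_eq_one v x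
    rwa [← ofReal_norm, ← ENNReal.ofReal_ofNat 3, ← ENNReal.ofReal_mul (by norm_num),
      ENNReal.ofReal_le_ofReal_iff (by positivity)] at this
  refine (eLpNorm_le_mul_eLpNorm_of_ae_le_mul (.of_forall this) 2).trans ?_
  rw [ENNReal.ofReal_pow (by positivity), ENNReal.ofReal_mul (by norm_num), ENNReal.ofReal_ofNat,
    mul_pow, pow_succ, ← mul_assoc]
  push_cast
  gcongr
  exact eLpNorm_two_le_H1norm v

/-- The Sobolev embedding `H¹ ⊂ Lᵗ` for a suitable `t > σ`, `t > Nσ / 2`. -/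
theorem exists_sobolev_exponent {N : ℕ} (hN : 1 ≤ N) {σ : ℝ} (hσ : 1 ≤ σ)
    (hσ' : 2 < N → σ < 4 / ((N : ℝ) - 2)) :
    ∃ (t : ℝ) (C : ℝ≥0), σ < t ∧ N * σ < 2 * t ∧
      ∀ v : 𝓢(EuclideanSpace ℝ (Fin N), ℂ),
        eLpNorm v (ENNReal.ofReal t) volume ≤ C * ENNReal.ofReal (H1norm N v) := by
  rcases lt_or_ge 2 N with h2 | h2
  · obtain ⟨C, hC⟩ := exists_eLpNorm_le_H1norm_of_two_lt h2
    have hN3 : (3 : ℝ) ≤ N := by exact_mod_cast h2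
    have hpos : 0 < (N : ℝ) - 2 := by linarith
    have hσ2 := (lt_div_iff₀ hpos).1 (hσ' h2)
    refine ⟨_, C, ?_, ?_, hC⟩
    · rw [lt_div_iff₀ hpos]
      linarith
    · rw [mul_div_assoc', lt_div_iff₀ hpos]
      nlinarith
  · have key : ∃ C : ℝ≥0, ∀ v : 𝓢(EuclideanSpace ℝ (Fin N), ℂ),
        eLpNorm v (2 * ⌈σ⌉₊) volume ≤ C * ENNReal.ofReal (H1norm N v) := by
      have hm : 1 ≤ ⌈σ⌉₊ := Nat.one_le_ceil_iff.2 (by linarith)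
      interval_cases N
      · exact exists_eLpNorm_le_H1norm_of_eq_one hm
      · exact exists_eLpNorm_le_H1norm_of_eq_two hm
    obtain ⟨C, hC⟩ := key
    have hc := Nat.le_ceil σ
    have hN2 : (N : ℝ) ≤ 2 := by exact_mod_cast h2
    refine ⟨2 * ⌈σ⌉₊, C, by linarith, by nlinarith, fun v => ?_⟩
    rw [ENNReal.ofReal_mul zero_le_two, ENNReal.ofReal_natCast, ENNReal.ofReal_ofNat]
    exact hC v

end Sobolev

theorem lap_eq_laplacian {N : ℕ} (w : SchwartzMap (EuclideanSpace ℝ (Fin N)) ℂ)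
    (x : EuclideanSpace ℝ (Fin N)) :
    lap N (fun y => w y) x = Laplacian.laplacian w x := by
  rw [SchwartzMap.laplacian_eq_sum (EuclideanSpace.basisFun (Fin N) ℝ)]
  simp only [lap, basisVec, _root_.sum_apply, EuclideanSpace.basisFun_apply]
  rfl

/-- (Lemma 3, second estimate) estimate for
`‖B(|v|^{σ-1}v)|v|^{σ-1}v(v₁-v₂)‖_{r'} ≤ C_α ‖v‖_{H¹}^{2σ} ‖v₁-v₂‖_r`,
where `w = B(|v|^{σ-1}v)` solves the Helmholtz equation `w - α²Δw = |v|^{σ-1}v`. -/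
theorem stmt3 (N : ℕ) (hN : 1 ≤ N) (α : ℝ) (hα : 0 < α) (σ : ℝ) (hσ : 1 ≤ σ)
    (hσ' : 2 < N → σ < 4 / ((N : ℝ) - 2)) :
    ∃ r r' : ℝ, 2 < r ∧ (2 < N → r ≤ 2 * N / ((N : ℝ) - 2)) ∧ 1 / r + 1 / r' = 1 ∧
      ∃ C : ℝ, 0 < C ∧
        ∀ (v : SchwartzMap (EuclideanSpace ℝ (Fin N)) ℂ)
          (w : SchwartzMap (EuclideanSpace ℝ (Fin N)) ℂ),
          (∀ x, w x - (α ^ 2 : ℂ) * lap N (fun y => w y) x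
              = ((‖v x‖ ^ (σ - 1) : ℝ) : ℂ) * v x) →
          ∀ (v₁ v₂ : SchwartzMap (EuclideanSpace ℝ (Fin N)) ℂ),
            LpN N (fun x =>
                w x * ((‖v x‖ ^ (σ - 1) : ℝ) : ℂ) * v x * (v₁ x - v₂ x)) r'
              ≤ C * (H1norm N (fun y => v y)) ^ (2 * σ) *
                  LpN N (fun x => v₁ x - v₂ x) r := by
  obtain ⟨t, C₁, hσt, hNt, hsob⟩ := exists_sobolev_exponent hN hσ hσ'
  have hσ0 : 0 < σ := by linarith
  have ht : 0 < t := by linarith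
  have hN0 : (0 : ℝ) < N := by exact_mod_cast hN
  have hθ : 0 < σ / t := by positivity
  have hθ1 : σ / t < 1 := (div_lt_one ht).2 hσt
  have hq : 1 < t / σ := (one_lt_div hσ0).2 hσt
  obtain ⟨C₂, hC₂, hsup⟩ := exists_norm_le_of_helmholtz (V := EuclideanSpace ℝ (Fin N))
    (c := α ^ 2) (by positivity) hq (by
      rw [finrank_euclideanSpace_fin, div_div, div_lt_one (by positivity), mul_div_assoc',
        lt_div_iff₀ hσ0]
      exact hNt)
  have h1θ : 0 < 1 - σ / t := by linarith
  refine ⟨2 / (1 - σ / t), 2 / (1 + σ / t), ?_, fun h2 => ?_, ?_, C₂ * C₁ ^ (2 * σ) + 1,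
    by positivity, fun v w hw v₁ v₂ => ?_⟩
  · rw [lt_div_iff₀ h1θ]; linarith
  · have hN2 : 0 < (N : ℝ) - 2 := by
      have : (2 : ℝ) < N := by exact_mod_cast h2
      linarith
    have : N * (σ / t) < 2 := by
      rw [mul_div_assoc', div_lt_iff₀ ht]; exact hNt
    rw [div_le_div_iff₀ h1θ hN2]
    nlinarith
  · rw [one_div_div, one_div_div]; ring
  set f := w - α ^ 2 • Laplacian.laplacian w with hf_def
  have hf : ∀ x, f x = ((‖v x‖ ^ (σ - 1) : ℝ) : ℂ) * v x := by
    intro x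
    rw [← hw x, lap_eq_laplacian, hf_def]
    simp
  have hfn : ∀ x, ‖f x‖ = ‖v x‖ ^ σ := by
    intro x
    rw [hf, norm_mul, Complex.norm_real, Real.norm_of_nonneg (by positivity)]
    rcases eq_or_ne (v x) 0 with h0 | h0
    · simp [h0, hσ0.ne']
    · nth_rewrite 2 [← Real.rpow_one ‖v x‖]
      rw [← Real.rpow_add (norm_pos_iff.2 h0), sub_add_cancel]
  set H := H1norm N (fun y => v y) with hH_def
  have hH : 0 ≤ H := Real.sqrt_nonneg _
  set B := (eLpNorm f (ENNReal.ofReal (t / σ)) volume).toReal with hB_def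
  have hB : B ≤ (C₁ * H) ^ σ := by
    have h1 : eLpNorm f (ENNReal.ofReal (t / σ)) volume =
        eLpNorm v (ENNReal.ofReal t) volume ^ σ := by
      rw [show t = t / σ * σ by field_simp, ENNReal.ofReal_mul (by positivity),
        ← eLpNorm_norm_rpow _ hσ0, mul_div_cancel_right₀ _ hσ0.ne']
      exact eLpNorm_congr_norm_ae (.of_forall fun x => by
        rw [hfn, Real.norm_of_nonneg (by positivity)])
    refine ENNReal.toReal_le_of_le_ofReal (by positivity) ?_
    rw [h1, ← ENNReal.ofReal_rpow_of_nonneg (by positivity) hσ0.le,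
      ENNReal.ofReal_mul C₁.coe_nonneg, ENNReal.ofReal_coe_nnreal]
    exact ENNReal.rpow_le_rpow (hsob v) hσ0.le
  set G := LpN N (fun x => v₁ x - v₂ x) (2 / (1 - σ / t)) with hG_def
  have hG : 0 ≤ G := ENNReal.toReal_nonneg
  have hmain : LpN N (fun x => w x * ((‖v x‖ ^ (σ - 1) : ℝ) : ℂ) * v x * (v₁ x - v₂ x))
      (2 / (1 + σ / t)) ≤ C₂ * B * (B * G) := by
    have hB0 : 0 ≤ B := ENNReal.toReal_nonneg
    have hfin : eLpNorm f (ENNReal.ofReal (t / σ)) volume ≠ ∞ := (f.memLp _ volume).2.ne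
    have hfin' : eLpNorm (v₁ - v₂) (ENNReal.ofReal (2 / (1 - σ / t))) volume ≠ ∞ :=
      ((v₁ - v₂).memLp _ volume).2.ne
    have htriple : ENNReal.HolderTriple (ENNReal.ofReal (t / σ))
        (ENNReal.ofReal (2 / (1 - σ / t))) (ENNReal.ofReal (2 / (1 + σ / t))) := by
      constructor
      rw [← ENNReal.ofReal_inv_of_pos (by positivity), ← ENNReal.ofReal_inv_of_pos (by positivity),
        ← ENNReal.ofReal_inv_of_pos (by positivity), ← ENNReal.ofReal_add (by positivity)
        (by positivity), inv_div, inv_div, inv_div]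
      congr 1
      ring
    have h1 : eLpNorm (fun x => w x * ((‖v x‖ ^ (σ - 1) : ℝ) : ℂ) * v x * (v₁ x - v₂ x))
        (ENNReal.ofReal (2 / (1 + σ / t))) volume ≤ ENNReal.ofReal (C₂ * B) *
          eLpNorm (⇑f • ⇑(v₁ - v₂)) (ENNReal.ofReal (2 / (1 + σ / t))) volume := by
      refine eLpNorm_le_mul_eLpNorm_of_ae_le_mul (.of_forall fun x => ?_) _
      rw [mul_assoc (w x), ← hf, mul_assoc, norm_mul]
      exact mul_le_mul_of_nonneg_right (hsup f w rfl x) (norm_nonneg _)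
    have h2 := eLpNorm_smul_le_mul_eLpNorm (μ := volume) (p := ENNReal.ofReal (t / σ))
      (q := ENNReal.ofReal (2 / (1 - σ / t))) (r := ENNReal.ofReal (2 / (1 + σ / t)))
      (v₁ - v₂).continuous.aestronglyMeasurable f.continuous.aestronglyMeasurable
    have h3 := ENNReal.toReal_mono (ENNReal.mul_ne_top ENNReal.ofReal_ne_top
      (ENNReal.mul_ne_top hfin hfin')) (h1.trans (mul_le_mul_right h2 _))
    rw [ENNReal.toReal_mul, ENNReal.toReal_mul, ENNReal.toReal_ofReal (by positivity)] at h3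
    exact h3
  calc _ ≤ C₂ * B * (B * G) := hmain
    _ ≤ C₂ * (C₁ * H) ^ σ * ((C₁ * H) ^ σ * G) := by gcongr
    _ = C₂ * C₁ ^ (2 * σ) * H ^ (2 * σ) * G := by
      rw [two_mul, Real.rpow_add_of_nonneg C₁.coe_nonneg hσ0.le hσ0.le,
        Real.rpow_add_of_nonneg hH hσ0.le hσ0.le, Real.mul_rpow C₁.coe_nonneg hH]
      ring
    _ ≤ (C₂ * C₁ ^ (2 * σ) + 1) * H ^ (2 * σ) * G := by
      gcongr
      linarith
end
end
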